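/- arXiv:2109.08797 — 9 statements merged into one kernel-verified Lean document; each statement's English description precedes it below -/
import Mathlib

section
/- Let ψ : ℝ³ → ℝ be infinitely differentiable whose spherical-coordinate representation Ψ satisfies the four orthogonality conditions ∫₀^{2π} ∫_{−π/2}^{π/2} Ψ cos θ dθ dφ = 0, ∫₀^{2π} ∫_{−π/2}^{π/2} Ψ sin θ cos θ dθ dφ = 0, ∫₀^{2π} ∫_{−π/2}^{π/2} Ψ cos φ cos²θ dθ dφ = 0 and ∫₀^{2π} ∫_{−π/2}^{π/2} Ψ sin φ cos²θ dθ dφ = 0 (ψ is orthogonal in L²(S²) to the constants and to the first eigenspace of the Laplace–Beltrami operator). Then ∫₀^{2π} ∫_{−π/2}^{π/2} (ΔΨ)² cos θ dθ dφ ≥ 6 ∫₀^{2π} ∫_{−π/2}^{π/2} [ (∂θΨ)² + (∂φΨ)²/cos²θ ] cos θ dθ dφ. -/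
open Real MeasureTheory

noncomputable section

/-- The point of the unit sphere with longitude `φ` and latitude `θ`. -/
def sphPt (φ θ : ℝ) : ℝ × ℝ × ℝ :=
  (Real.cos φ * Real.cos θ, Real.sin φ * Real.cos θ, Real.sin θ)

/-- The spherical-coordinate representation of a function `ψ : ℝ³ → ℝ`. -/
def sphRep (ψ : ℝ × ℝ × ℝ → ℝ) (φ θ : ℝ) : ℝ := ψ (sphPt φ θ)

/-- The Laplace–Beltrami operator of the unit sphere in longitude-latitude coordinates:
`(ΔΨ)(φ,θ) = ∂θ²Ψ − tan θ · ∂θΨ + (1/cos²θ) · ∂φ²Ψ`. -/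
def LB (Ψ : ℝ → ℝ → ℝ) (φ θ : ℝ) : ℝ :=
  iteratedDeriv 2 (fun θ' => Ψ φ θ') θ
    - Real.tan θ * deriv (fun θ' => Ψ φ θ') θ
    + (1 / Real.cos θ ^ 2) * iteratedDeriv 2 (fun φ' => Ψ φ' θ) φ

lemma norm_sq_exp_integral (f : ℝ → ℝ) (hf : Continuous f) (s : ℝ) (hs : s = 1 ∨ s = -1) :
    ‖∫ x in (0:ℝ)..(2*π), Complex.exp (s * x * Complex.I) * (f x : ℂ)‖ ^ 2
      = (∫ x in (0:ℝ)..(2*π), f x * cos x) ^ 2 + (∫ x in (0:ℝ)..(2*π), f x * sin x) ^ 2 := by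
  have h : ∀ x : ℝ, Complex.exp (s * x * Complex.I) * (f x : ℂ)
      = ((f x * cos x : ℝ) : ℂ) + ((s * (f x * sin x) : ℝ) : ℂ) * Complex.I := by
    intro x
    have : (s * x * Complex.I : ℂ) = ((s * x : ℝ) : ℂ) * Complex.I := by push_cast; ring
    rw [this, Complex.exp_mul_I, ← Complex.ofReal_cos, ← Complex.ofReal_sin]
    rcases hs with rfl | rfl <;> simp <;> ring
  simp_rw [h]
  rw [intervalIntegral.integral_add, intervalIntegral.integral_mul_const,
    intervalIntegral.integral_ofReal, intervalIntegral.integral_ofReal,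
    intervalIntegral.integral_const_mul, ← Complex.normSq_eq_norm_sq, Complex.normSq_add_mul_I]
  · rcases hs with rfl | rfl <;> ring
  · apply Continuous.intervalIntegrable; fun_prop
  · apply Continuous.intervalIntegrable; fun_prop

lemma wirtinger_second (f f' : ℝ → ℝ) (hf' : Continuous f') (hd : ∀ x, HasDerivAt f (f' x) x)
    (hper : f 0 = f (2*π)) :
    4 * ((∫ x in (0:ℝ)..(2*π), f x ^ 2) - (∫ x in (0:ℝ)..(2*π), f x) ^ 2 / (2*π)
        - ((∫ x in (0:ℝ)..(2*π), f x * cos x) ^ 2 + (∫ x in (0:ℝ)..(2*π), f x * sin x) ^ 2) / π)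
      ≤ (∫ x in (0:ℝ)..(2*π), f' x ^ 2)
        - ((∫ x in (0:ℝ)..(2*π), f x * cos x) ^ 2
          + (∫ x in (0:ℝ)..(2*π), f x * sin x) ^ 2) / π := by
  have hf : Continuous f := continuous_iff_continuousAt.2 fun x => (hd x).continuousAt
  have hab : (0:ℝ) < 2 * π := by positivity
  have hpi := pi_pos
  have hL : ∀ g : ℝ → ℝ, Continuous g →
      HasSum (fun i => ‖fourierCoeffOn hab (fun x => (g x : ℂ)) i‖ ^ 2)
        ((2*π)⁻¹ * ∫ x in (0:ℝ)..(2*π), g x ^ 2) := by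
    intro g hg
    have hm : MemLp (fun x => (g x : ℂ)) 2 (volume.restrict (Set.Ioc 0 (2*π))) := by
      have : Continuous (fun x => (g x : ℂ)) := by fun_prop
      refine (memLp_two_iff_integrable_sq_norm this.aestronglyMeasurable).2 ?_
      have h2 : Continuous (fun x => ‖(g x : ℂ)‖ ^ 2) := by fun_prop
      exact (h2.integrableOn_Icc).mono_set Set.Ioc_subset_Icc_self
    have := hasSum_sq_fourierCoeffOn hab hm
    simpa using this
  have hco : ∀ n : ℤ, ‖fourierCoeffOn hab (fun x => (f' x : ℂ)) n‖ ^ 2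
      = n ^ 2 * ‖fourierCoeffOn hab (fun x => (f x : ℂ)) n‖ ^ 2 := by
    intro n
    by_cases hn : n = 0
    · subst hn
      rw [fourierCoeffOn_eq_integral]
      have : ∫ x in (0:ℝ)..(2*π), f' x = 0 := by
        rw [intervalIntegral.integral_eq_sub_of_hasDerivAt (fun x _ => hd x)
          (hf'.intervalIntegrable _ _), hper, sub_self]
      simp [this, intervalIntegral.integral_ofReal]
    · have h := fourierCoeffOn_of_hasDerivAt hab (f := fun x => (f x : ℂ))
        (f' := fun x => (f' x : ℂ)) hn (fun x _ => (hd x).ofReal_comp)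
        ((by fun_prop : Continuous fun x => (f' x : ℂ)).intervalIntegrable _ _)
      rw [h]
      simp only [hper, sub_self, mul_zero, zero_sub]
      have hn' : (|(n:ℝ)|) ≠ 0 := by simpa using hn
      have habs := sq_abs (n:ℝ)
      simp [abs_of_pos hpi]
      field_simp
      rw [habs]
  have h0 : ‖fourierCoeffOn hab (fun x => (f x : ℂ)) 0‖ ^ 2
      = (∫ x in (0:ℝ)..(2*π), f x) ^ 2 / (4 * π ^ 2) := by
    rw [fourierCoeffOn_eq_integral]
    simp [intervalIntegral.integral_ofReal, abs_of_pos hpi]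
    rw [mul_pow, mul_pow, sq_abs]; field_simp; norm_num; ring
  have h1 : ∀ n : ℤ, (n = 1 ∨ n = -1) → ‖fourierCoeffOn hab (fun x => (f x : ℂ)) n‖ ^ 2
      = ((∫ x in (0:ℝ)..(2*π), f x * cos x) ^ 2
          + (∫ x in (0:ℝ)..(2*π), f x * sin x) ^ 2) / (4 * π ^ 2) := by
    intro n hn
    rw [fourierCoeffOn_eq_integral, ← norm_sq_exp_integral f hf (-n) (by
      rcases hn with rfl | rfl <;> simp), norm_smul, mul_pow]
    have : ∀ x : ℝ, (fourier (-n) (x : AddCircle (2*π - 0)) • (f x : ℂ))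
        = Complex.exp (((-n : ℝ) : ℂ) * x * Complex.I) * (f x : ℂ) := by
      intro x
      rw [fourier_coe_apply, smul_eq_mul]
      congr 2
      have : (π : ℂ) ≠ 0 := by exact_mod_cast hpi.ne'
      push_cast
      field_simp
      simp
      ring
    simp_rw [this]
    generalize ‖∫ x in (0:ℝ)..(2*π), Complex.exp (((-n : ℝ) : ℂ) * x * Complex.I) * (f x : ℂ)‖ = K
    rw [sub_zero, Real.norm_of_nonneg (by positivity)]
    field_simp
    ring
  have hs := (hL f' hf').sub ((hL f hf).mul_left 4)
  have hle := sum_le_hasSum ({-1, 0, 1} : Finset ℤ) (fun n hn => by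
    rw [hco]
    have : 4 ≤ n ^ 2 := by
      have : n ≤ -2 ∨ 2 ≤ n := by simp at hn; omega
      rcases this with h | h <;> nlinarith
    have : (4:ℝ) ≤ (n:ℝ) ^ 2 := by exact_mod_cast this
    nlinarith [sq_nonneg ‖fourierCoeffOn hab (fun x => (f x : ℂ)) n‖]) hs
  simp only [hco] at hle
  rw [Finset.sum_insert (by simp), Finset.sum_insert (by simp), Finset.sum_singleton,
    h0, h1 1 (by simp), h1 (-1) (by simp)] at hle
  generalize (∫ x in (0:ℝ)..(2*π), f x) = m0 at *
  generalize (∫ x in (0:ℝ)..(2*π), f x * cos x) ^ 2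
          + (∫ x in (0:ℝ)..(2*π), f x * sin x) ^ 2 = m1 at *
  generalize (∫ x in (0:ℝ)..(2*π), f x ^ 2) = F at *
  generalize (∫ x in (0:ℝ)..(2*π), f' x ^ 2) = F' at *
  have h2 := mul_le_mul_of_nonneg_left hle hab.le
  push_cast at h2
  have e1 : 2 * π * ((2 * π)⁻¹ * F' - 4 * ((2 * π)⁻¹ * F)) = F' - 4 * F := by field_simp
  rw [e1] at h2
  refine le_of_sub_nonneg ((sub_nonneg.2 h2).trans_eq ?_)
  field_simp
  ring

lemma hasDerivAt_intervalIntegral_of_continuous (F F' : ℝ → ℝ → ℝ)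
    (hF : Continuous F.uncurry) (hF' : Continuous F'.uncurry)
    (hd : ∀ φ θ, HasDerivAt (fun t => F φ t) (F' φ θ) θ) (a b θ : ℝ) :
    HasDerivAt (fun t => ∫ φ in a..b, F φ t) (∫ φ in a..b, F' φ θ) θ := by
  obtain ⟨C, hC⟩ := (isCompact_uIcc.prod (isCompact_Icc (a := θ - 1) (b := θ + 1))).exists_bound_of_continuousOn
    (f := F'.uncurry) (s := Set.uIcc a b ×ˢ Set.Icc (θ - 1) (θ + 1)) hF'.continuousOn
  have hc : ∀ t, Continuous fun φ => F φ t := fun t => hF.comp (by fun_prop : Continuous fun φ => (φ, t))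
  have hc' : ∀ t, Continuous fun φ => F' φ t :=
    fun t => hF'.comp (by fun_prop : Continuous fun φ => (φ, t))
  refine (intervalIntegral.hasDerivAt_integral_of_dominated_loc_of_deriv_le
    (F := fun t φ => F φ t) (F' := fun t φ => F' φ t) (bound := fun _ => C)
    (Icc_mem_nhds (by linarith : θ - 1 < θ) (by linarith : θ < θ + 1))
    (.of_forall fun t => (hc t).aestronglyMeasurable) ((hc θ).intervalIntegrable _ _)
    (hc' θ).aestronglyMeasurable ?_ (by simp) ?_).2
  · exact .of_forall fun φ hφ t ht => hC (φ, t) ⟨Set.uIoc_subset_uIcc hφ, ht⟩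
  · exact .of_forall fun φ _ t _ => hd φ t

lemma intervalIntegral_swap_of_continuous (F : ℝ → ℝ → ℝ) (hF : Continuous F.uncurry)
    (a b c d : ℝ) :
    ∫ x in a..b, ∫ y in c..d, F x y = ∫ y in c..d, ∫ x in a..b, F x y := by
  apply intervalIntegral_intervalIntegral_swap
  exact (hF.continuousOn.integrableOn_compact (isCompact_uIcc.prod isCompact_uIcc)).mono_set
    (Set.prod_mono Set.uIoc_subset_uIcc Set.uIoc_subset_uIcc)

lemma continuousAt_sq_mul_inv {u f : ℝ → ℝ} {u' f' x : ℝ} (hu : HasDerivAt u u' x)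
    (hf : HasDerivAt f f' x) (hu0 : u x = 0) (hf0 : f x = 0) (hf' : f' ≠ 0) :
    ContinuousAt (fun t => u t ^ 2 * (f t)⁻¹) x := by
  rw [← continuousWithinAt_compl_self, ContinuousWithinAt]
  have h1 := (hasDerivAt_iff_tendsto_slope.1 hu).mul ((hasDerivAt_iff_tendsto_slope.1 hf).inv₀ hf')
  have h2 := (hu.continuousAt.tendsto.mono_left nhdsWithin_le_nhds).mul h1
  rw [hu0, zero_mul] at h2
  simp only [hu0, hf0]
  rw [zero_pow two_ne_zero, zero_mul]
  refine h2.congr' ?_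
  filter_upwards [self_mem_nhdsWithin] with t ht
  have : t - x ≠ 0 := sub_ne_zero.2 ht
  simp only [slope, hu0, hf0, vsub_eq_sub, sub_zero, smul_eq_mul, mul_inv, inv_inv]
  field_simp

lemma integral_nonneg_of_nodal_solution {w w' f f' f'' Q φ : ℝ → ℝ} {l r : ℝ} (hlr : l ≤ r)
    (hl : -(π / 2) ≤ l) (hr : r ≤ π / 2)
    (hw : ∀ t, HasDerivAt w (w' t) t) (hf : ∀ t, HasDerivAt f (f' t) t)
    (hf' : ∀ t, HasDerivAt f' (f'' t) t) (hφ : Continuous φ)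
    (hne : ∀ t ∈ Set.Ioo l r, f t ≠ 0)
    (hzero : ∀ t ∈ Set.Icc l r, f t = 0 → w t = 0 ∧ f' t ≠ 0)
    (hode : ∀ t ∈ Set.Ioo l r, cos t * f'' t - sin t * f' t = Q t * f t)
    (hle : ∀ t ∈ Set.Ioo l r, cos t * w' t ^ 2 + Q t * w t ^ 2 ≤ φ t)
    (hel : cos l = 0 ∨ f l = 0) (her : cos r = 0 ∨ f r = 0) :
    0 ≤ ∫ t in l..r, φ t := by
  have key := intervalIntegral.sub_le_integral_of_hasDeriv_right_of_le (φ := φ)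
    (g := fun t => cos t * f' t * (w t ^ 2 * (f t)⁻¹))
    (g' := fun t => (-sin t * f' t + cos t * f'' t) * (w t ^ 2 * (f t)⁻¹)
      + cos t * f' t * (2 * w t * w' t * (f t)⁻¹ + w t ^ 2 * (-f' t / f t ^ 2))) hlr ?_ ?_
    hφ.integrableOn_Icc ?_
  · have h0 : ∀ t, (cos t = 0 ∨ f t = 0) → cos t * f' t * (w t ^ 2 * (f t)⁻¹) = 0 := by
      rintro t (h | h) <;> simp [h]
    simpa [h0 l hel, h0 r her] using key
  · intro t ht
    refine ContinuousAt.continuousWithinAt ?_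
    refine (continuous_cos.continuousAt.mul (hf' t).continuousAt).mul ?_
    by_cases h : f t = 0
    · exact continuousAt_sq_mul_inv (hw t) (hf t) (hzero t ht h).1 h (hzero t ht h).2
    · exact ((hw t).continuousAt.pow 2).mul ((hf t).continuousAt.inv₀ h)
  · intro t ht
    have h := ((hasDerivAt_cos t).mul (hf' t)).mul
      (((hw t).pow 2).mul ((hf t).inv (hne t ht)))
    refine (h.congr_deriv ?_).hasDerivWithinAt
    simp
  · intro t ht
    have hc : 0 ≤ cos t := cos_nonneg_of_mem_Icc ⟨by linarith [ht.1], by linarith [ht.2]⟩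
    refine le_trans ?_ (hle t ht)
    have hn := hne t ht
    have : Q t = (cos t * f'' t - sin t * f' t) / f t := by
      rw [hode t ht]; field_simp
    rw [this]
    have h2 : 0 ≤ cos t * (w' t - w t * f' t / f t) ^ 2 := by positivity
    refine le_of_sub_nonneg (h2.trans_eq ?_)
    field_simp
    ring

lemma integral_nonneg_zonal {a a' : ℝ → ℝ} (ha : ∀ t, HasDerivAt a (a' t) t)
    (ha' : Continuous a') (h0 : ∫ t in (-(π/2))..(π/2), a t * cos t = 0)
    (h1 : ∫ t in (-(π/2))..(π/2), a t * sin t * cos t = 0) :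
    0 ≤ ∫ t in (-(π/2))..(π/2), cos t * (a' t ^ 2 - 6 * a t ^ 2) := by
  have hac : Continuous a := continuous_iff_continuousAt.2 fun x => (ha x).continuousAt
  obtain ⟨τ, hτ0, hτ1, hτ⟩ : ∃ τ, 0 < τ ∧ τ < π / 2 ∧ 3 * sin τ ^ 2 = 1 := by
    have h3 : (0:ℝ) < √3 := by positivity
    have h31 : (√3)⁻¹ < 1 := inv_lt_one_of_one_lt₀ (by
      rw [Real.lt_sqrt (by norm_num)]; norm_num)
    refine ⟨arcsin (√3)⁻¹, arcsin_pos.2 (by positivity), arcsin_lt_pi_div_two.2 h31, ?_⟩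
    rw [sin_arcsin (by linarith [inv_pos.2 h3]) h31.le]
    simp
  have hsτ : 0 < sin τ := sin_pos_of_pos_of_lt_pi hτ0 (by linarith [pi_pos])
  obtain ⟨p, q, hp, hm⟩ : ∃ p q, a τ - p - q * sin τ = 0 ∧ a (-τ) - p - q * sin (-τ) = 0 := by
    refine ⟨(a τ + a (-τ)) / 2, (a τ - a (-τ)) / (2 * sin τ), ?_, ?_⟩
    · field_simp; ring
    · rw [sin_neg]; field_simp; ring
  set φ : ℝ → ℝ := fun t => cos t * (a' t - q * cos t) ^ 2 - 6 * cos t * (a t - p - q * sin t) ^ 2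
    with hφdef
  have hφ : Continuous φ := by fun_prop
  have hnodal : ∀ l r, l ≤ r → -(π / 2) ≤ l → r ≤ π / 2 →
      (∀ t ∈ Set.Ioo l r, 3 * sin t ^ 2 - 1 ≠ 0) →
      (cos l = 0 ∨ 3 * sin l ^ 2 - 1 = 0) → (cos r = 0 ∨ 3 * sin r ^ 2 - 1 = 0) →
      0 ≤ ∫ t in l..r, φ t := by
    intro l r hlr hl hr hne hel her
    refine integral_nonneg_of_nodal_solution (w := fun t => a t - p - q * sin t)
      (w' := fun t => a' t - q * cos t) (f := fun t => 3 * sin t ^ 2 - 1)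
      (f' := fun t => 6 * sin t * cos t) (f'' := fun t => 6 * cos t ^ 2 - 6 * sin t ^ 2)
      (Q := fun t => - 6 * cos t) hlr hl hr ?_ ?_ ?_ hφ hne ?_ ?_ ?_ hel her
    · intro t
      exact ((ha t).sub_const p).sub ((hasDerivAt_sin t).const_mul q)
    · intro t
      refine ((((hasDerivAt_sin t).pow 2).const_mul 3).sub_const 1).congr_deriv ?_
      push_cast; ring
    · intro t
      refine (((hasDerivAt_sin t).const_mul 6).mul (hasDerivAt_cos t)).congr_deriv ?_
      ring
    · intro t ht h
      have hc := sin_sq_add_cos_sq t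
      constructor
      · have h' : (sin t - sin τ) * (sin t - sin (-τ)) = 0 := by
          rw [sin_neg]; linear_combination (h - hτ) / 3
        have hmem : t ∈ Set.Icc (-(π / 2)) (π / 2) := ⟨hl.trans ht.1, ht.2.trans hr⟩
        rcases mul_eq_zero.1 h' with h' | h'
        · rw [injOn_sin hmem ⟨by linarith, by linarith⟩ (sub_eq_zero.1 h')]; exact hp
        · rw [injOn_sin hmem ⟨by linarith, by linarith⟩ (sub_eq_zero.1 h')]; exact hm
      · intro h6
        have h7 : 36 * sin t ^ 2 * cos t ^ 2 = 0 := by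
          linear_combination (6 * sin t * cos t) * h6
        have h8 : sin t ^ 2 = 1 / 3 := by linarith
        have h9 : cos t ^ 2 = 2 / 3 := by linarith
        rw [h8, h9] at h7
        norm_num at h7
    · intro t _
      have hc := sin_sq_add_cos_sq t
      linear_combination (6 * cos t) * hc
    · intro t _
      simp only [hφdef]
      linarith
  have hmono : ∀ x y, -(π / 2) ≤ x → x < y → y ≤ π / 2 → sin x < sin y :=
    fun x y hx hxy hy => sin_lt_sin_of_lt_of_le_pi_div_two hx hy hxy
  have i1 := hnodal (-(π / 2)) (-τ) (by linarith) le_rfl (by linarith) (fun t ht => by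
    have := hmono t (-τ) ht.1.le ht.2 (by linarith)
    rw [sin_neg] at this
    nlinarith) (by simp) (by right; rw [sin_neg]; linarith)
  have i2 := hnodal (-τ) τ (by linarith) (by linarith) (by linarith) (fun t ht => by
    have h1 := hmono (-τ) t (by linarith) ht.1 (by linarith [ht.2])
    have h2 := hmono t τ (by linarith [ht.1]) ht.2 (by linarith)
    rw [sin_neg] at h1
    nlinarith) (by right; rw [sin_neg]; linarith) (by right; linarith)
  have i3 := hnodal τ (π / 2) (by linarith) (by linarith) le_rfl (fun t ht => by
    have := hmono τ t (by linarith) ht.1 ht.2.le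
    nlinarith) (by right; linarith) (by simp)
  have hsum : 0 ≤ ∫ t in (-(π/2))..(π/2), φ t := by
    rw [← intervalIntegral.integral_add_adjacent_intervals (hφ.intervalIntegrable _ (-τ))
      (hφ.intervalIntegrable _ _), ← intervalIntegral.integral_add_adjacent_intervals
      (hφ.intervalIntegrable (-τ) τ) (hφ.intervalIntegrable _ _)]
    linarith
  have hG : ∀ t, HasDerivAt (fun t => 2 * q * (cos t ^ 2 * a t) + 6 * p ^ 2 * sin t
      + 6 * p * q * sin t ^ 2 + 7 / 3 * q ^ 2 * sin t ^ 3 - q ^ 2 * sin t)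
      (cos t * (a' t ^ 2 - 6 * a t ^ 2) - φ t + 8 * q * (a t * sin t * cos t)
        + 12 * p * (a t * cos t)) t := by
    intro t
    have hs := hasDerivAt_sin t
    refine (((((((hasDerivAt_cos t).pow 2).mul (ha t)).const_mul (2 * q)).add
      (hs.const_mul (6 * p ^ 2))).add ((hs.pow 2).const_mul (6 * p * q))).add
      ((hs.pow 3).const_mul (7 / 3 * q ^ 2))).sub (hs.const_mul (q ^ 2)) |>.congr_deriv ?_
    simp only [hφdef]
    have hc := sin_sq_add_cos_sq t
    simp
    linear_combination (q ^ 2 * cos t) * hc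
  have hint := intervalIntegral.integral_eq_sub_of_hasDerivAt (a := -(π/2)) (b := π/2)
    (fun t _ => hG t) (Continuous.intervalIntegrable (by fun_prop) _ _)
  rw [intervalIntegral.integral_add, intervalIntegral.integral_add, intervalIntegral.integral_sub,
    intervalIntegral.integral_const_mul, intervalIntegral.integral_const_mul, h0, h1] at hint
  · simp only [sin_neg, cos_neg, sin_pi_div_two, cos_pi_div_two] at hint
    nlinarith [sq_nonneg p, sq_nonneg q]
  all_goals exact Continuous.intervalIntegrable (by fun_prop) _ _

lemma integral_nonneg_dipole {b b' β : ℝ → ℝ} (hb : ∀ t, HasDerivAt b (b' t) t)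
    (hb' : Continuous b') (hβ : Continuous β) (hbβ : ∀ t, b t = cos t * β t)
    (h0 : ∫ t in (-(π/2))..(π/2), b t * cos t ^ 2 = 0) :
    0 ≤ ∫ t in (-(π/2))..(π/2), cos t * (b' t ^ 2 + β t ^ 2 - 6 * b t ^ 2) := by
  have hbc : Continuous b := continuous_iff_continuousAt.2 fun x => (hb x).continuousAt
  set κ := b 0
  set φ : ℝ → ℝ := fun t => cos t * ((b' t + κ * sin t) ^ 2 + (β t - κ) ^ 2
    - 6 * (b t - κ * cos t) ^ 2) with hφdef
  have hφ : Continuous φ := by fun_prop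
  have hnodal : ∀ l r, l ≤ r → -(π / 2) ≤ l → r ≤ π / 2 →
      (∀ t ∈ Set.Ioo l r, cos t ≠ 0 ∧ sin t ≠ 0) →
      (sin l * cos l = 0) → (sin r * cos r = 0) → 0 ≤ ∫ t in l..r, φ t := by
    intro l r hlr hl hr hne hel her
    refine integral_nonneg_of_nodal_solution (w := fun t => b t - κ * cos t)
      (w' := fun t => b' t + κ * sin t) (f := fun t => sin t * cos t)
      (f' := fun t => cos t ^ 2 - sin t ^ 2) (f'' := fun t => - 4 * sin t * cos t)
      (Q := fun t => 1 / cos t - 6 * cos t) hlr hl hr ?_ ?_ ?_ hφ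
      (fun t ht => mul_ne_zero (hne t ht).2 (hne t ht).1) ?_ ?_ ?_ (.inr hel) (.inr her)
    · intro t
      refine ((hb t).sub ((hasDerivAt_cos t).const_mul κ)).congr_deriv ?_
      ring
    · intro t
      refine ((hasDerivAt_sin t).mul (hasDerivAt_cos t)).congr_deriv ?_
      ring
    · intro t
      refine (((hasDerivAt_cos t).pow 2).sub ((hasDerivAt_sin t).pow 2)).congr_deriv ?_
      simp; ring
    · intro t ht h
      have hc := sin_sq_add_cos_sq t
      constructor
      · rcases mul_eq_zero.1 h with h | h
        · have : t = 0 := by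
            refine injOn_sin ⟨hl.trans ht.1, ht.2.trans hr⟩ ⟨?_, ?_⟩ (by simpa using h) <;>
            linarith [pi_pos]
          subst this
          simp [κ]
        · simp only [hbβ t, h]; ring
      · rcases mul_eq_zero.1 h with h | h
        · rw [h] at hc ⊢; intro h'; linarith
        · rw [h] at hc ⊢; intro h'; linarith
    · intro t ht
      have hc := sin_sq_add_cos_sq t
      have := (hne t ht).1
      field_simp
      linear_combination sin t * hc
    · intro t ht
      have := (hne t ht).1
      simp only [hφdef, hbβ t]
      apply le_of_eq
      field_simp
      ring
  have i1 := hnodal (-(π / 2)) 0 (by linarith [pi_pos]) le_rfl (by linarith [pi_pos])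
    (fun t ht => ⟨(cos_pos_of_mem_Ioo ⟨ht.1, by linarith [pi_pos, ht.2]⟩).ne',
      (sin_neg_of_neg_of_neg_pi_lt ht.2 (by linarith [pi_pos, ht.1])).ne⟩) (by simp) (by simp)
  have i2 := hnodal 0 (π / 2) (by linarith [pi_pos]) (by linarith [pi_pos]) le_rfl
    (fun t ht => ⟨(cos_pos_of_mem_Ioo ⟨by linarith [pi_pos, ht.1], ht.2⟩).ne',
      (sin_pos_of_pos_of_lt_pi ht.1 (by linarith [pi_pos, ht.2])).ne'⟩) (by simp) (by simp)
  have hsum : 0 ≤ ∫ t in (-(π/2))..(π/2), φ t := by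
    rw [← intervalIntegral.integral_add_adjacent_intervals (hφ.intervalIntegrable _ 0)
      (hφ.intervalIntegrable _ _)]
    linarith
  have hG : ∀ t, HasDerivAt (fun t => - 2 * κ * (sin t * cos t * b t)
      + κ ^ 2 * (5 * sin t - 7 / 3 * sin t ^ 3))
      (cos t * (b' t ^ 2 + β t ^ 2 - 6 * b t ^ 2) - φ t + 8 * κ * (b t * cos t ^ 2)) t := by
    intro t
    have hs := hasDerivAt_sin t
    refine ((((hs.mul (hasDerivAt_cos t)).mul (hb t)).const_mul (-2 * κ)).add
      (((hs.const_mul 5).sub ((hs.pow 3).const_mul (7 / 3))).const_mul (κ ^ 2))).congr_deriv ?_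
    simp only [hφdef]
    have hc := sin_sq_add_cos_sq t
    simp [hbβ t]
    linear_combination (2 * κ * cos t * β t - 6 * κ ^ 2 * cos t) * hc
  have hint := intervalIntegral.integral_eq_sub_of_hasDerivAt (a := -(π/2)) (b := π/2)
    (fun t _ => hG t) (Continuous.intervalIntegrable (by fun_prop) _ _)
  rw [intervalIntegral.integral_add, intervalIntegral.integral_sub,
    intervalIntegral.integral_const_mul, h0] at hint
  · simp only [sin_neg, cos_neg, sin_pi_div_two, cos_pi_div_two] at hint
    nlinarith [sq_nonneg κ]
  all_goals exact Continuous.intervalIntegrable (by fun_prop) _ _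

lemma bessel_first_harmonics (f : ℝ → ℝ) (hf : Continuous f) :
    0 ≤ (∫ x in (0:ℝ)..(2*π), f x ^ 2) - (∫ x in (0:ℝ)..(2*π), f x) ^ 2 / (2*π)
        - ((∫ x in (0:ℝ)..(2*π), f x * cos x) ^ 2
          + (∫ x in (0:ℝ)..(2*π), f x * sin x) ^ 2) / π := by
  have hpi := pi_pos
  set A := (∫ x in (0:ℝ)..(2*π), f x) / (2 * π) with hA
  set B := (∫ x in (0:ℝ)..(2*π), f x * cos x) / π with hB
  set C := (∫ x in (0:ℝ)..(2*π), f x * sin x) / π with hC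
  have hP : ∫ x in (0:ℝ)..(2*π), (A + B * cos x + C * sin x) ^ 2
      = 2 * π * A ^ 2 + π * B ^ 2 + π * C ^ 2 := by
    have hG : ∀ x, HasDerivAt (fun x => (A ^ 2 + B ^ 2 / 2 + C ^ 2 / 2) * x + 2 * A * B * sin x
        - 2 * A * C * cos x + (B ^ 2 - C ^ 2) / 2 * (sin x * cos x) + B * C * sin x ^ 2)
        ((A + B * cos x + C * sin x) ^ 2) x := by
      intro x
      have hs := hasDerivAt_sin x
      have hc := hasDerivAt_cos x
      refine ((((((hasDerivAt_id x).const_mul (A ^ 2 + B ^ 2 / 2 + C ^ 2 / 2)).add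
        (hs.const_mul (2 * A * B))).sub (hc.const_mul (2 * A * C))).add
        ((hs.mul hc).const_mul ((B ^ 2 - C ^ 2) / 2))).add
        ((hs.pow 2).const_mul (B * C))).congr_deriv ?_
      have h1 := sin_sq_add_cos_sq x
      push_cast
      linear_combination (- (B ^ 2 + C ^ 2) / 2) * h1
    rw [intervalIntegral.integral_eq_sub_of_hasDerivAt (fun x _ => hG x)
      (Continuous.intervalIntegrable (by fun_prop) _ _)]
    simp
    ring
  have h0 : 0 ≤ ∫ x in (0:ℝ)..(2*π), (f x - (A + B * cos x + C * sin x)) ^ 2 :=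
    intervalIntegral.integral_nonneg (by positivity) fun x _ => sq_nonneg _
  have hexp : ∀ x, (f x - (A + B * cos x + C * sin x)) ^ 2
      = f x ^ 2 - 2 * A * f x - 2 * B * (f x * cos x) - 2 * C * (f x * sin x)
        + (A + B * cos x + C * sin x) ^ 2 := fun x => by ring
  simp_rw [hexp] at h0
  rw [intervalIntegral.integral_add, intervalIntegral.integral_sub, intervalIntegral.integral_sub,
    intervalIntegral.integral_sub, intervalIntegral.integral_const_mul,
    intervalIntegral.integral_const_mul, intervalIntegral.integral_const_mul, hP] at h0
  · rw [eq_div_iff (by positivity)] at hA hB hC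
    rw [← hA, ← hB, ← hC] at h0 ⊢
    refine h0.trans_eq ?_
    field_simp
    ring
  all_goals exact Continuous.intervalIntegrable (by fun_prop) _ _

lemma integral_mul_cos_eq (f g : ℝ → ℝ) (hg : Continuous g) (hd : ∀ x, HasDerivAt f (g x) x) :
    ∫ x in (0:ℝ)..(2*π), f x * cos x = -∫ x in (0:ℝ)..(2*π), g x * sin x := by
  rw [intervalIntegral.integral_mul_deriv_eq_deriv_mul (fun x _ => hd x)
    (fun x _ => hasDerivAt_sin x) (hg.intervalIntegrable _ _)
    (continuous_cos.intervalIntegrable _ _)]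
  simp

lemma integral_mul_sin_eq (f g : ℝ → ℝ) (hg : Continuous g) (hd : ∀ x, HasDerivAt f (g x) x)
    (hper : f 0 = f (2 * π)) :
    ∫ x in (0:ℝ)..(2*π), f x * sin x = ∫ x in (0:ℝ)..(2*π), g x * cos x := by
  have h := intervalIntegral.integral_mul_deriv_eq_deriv_mul (a := 0) (b := 2 * π)
    (fun x _ => hd x) (fun x _ => hasDerivAt_cos x) (hg.intervalIntegrable _ _)
    (continuous_sin.neg.intervalIntegrable _ _)
  simp only [mul_neg, intervalIntegral.integral_neg, cos_zero, cos_two_pi, hper] at h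
  linarith

lemma poincare_sphere_coordinates (Ψ Ψθ G : ℝ → ℝ → ℝ) (hΨ : Continuous Ψ.uncurry)
    (hΨθ : Continuous Ψθ.uncurry) (hG : Continuous G.uncurry)
    (hdθ : ∀ φ θ, HasDerivAt (fun t => Ψ φ t) (Ψθ φ θ) θ)
    (hdφ : ∀ φ θ, HasDerivAt (fun x => Ψ x θ) (cos θ * G φ θ) φ)
    (hper : ∀ θ, Ψ 0 θ = Ψ (2 * π) θ)
    (hmean : (∫ φ in (0:ℝ)..(2*π), ∫ θ in (-(π/2))..(π/2), Ψ φ θ * cos θ) = 0)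
    (horth0 : (∫ φ in (0:ℝ)..(2*π), ∫ θ in (-(π/2))..(π/2), Ψ φ θ * sin θ * cos θ) = 0)
    (horth1 : (∫ φ in (0:ℝ)..(2*π), ∫ θ in (-(π/2))..(π/2), Ψ φ θ * cos φ * cos θ ^ 2) = 0)
    (horth2 : (∫ φ in (0:ℝ)..(2*π), ∫ θ in (-(π/2))..(π/2), Ψ φ θ * sin φ * cos θ ^ 2) = 0) :
    0 ≤ ∫ φ in (0:ℝ)..(2*π), ∫ θ in (-(π/2))..(π/2),
      (Ψθ φ θ ^ 2 + G φ θ ^ 2 - 6 * Ψ φ θ ^ 2) * cos θ := by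
  have hpi := pi_pos
  have hΨφ : ∀ θ, Continuous fun φ => Ψ φ θ := fun θ => by fun_prop
  have hΨθφ : ∀ θ, Continuous fun φ => Ψθ φ θ := fun θ => by fun_prop
  have hGφ : ∀ θ, Continuous fun φ => G φ θ := fun θ => by fun_prop
  rw [intervalIntegral_swap_of_continuous _ (by simp only [Function.uncurry_def]; fun_prop)]
    at hmean horth0 horth1 horth2 ⊢
  simp only [intervalIntegral.integral_mul_const] at hmean horth0 horth1 horth2 ⊢
  set m0 : ℝ → ℝ := fun θ => ∫ φ in (0:ℝ)..(2*π), Ψ φ θ with hm0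
  set mc : ℝ → ℝ := fun θ => ∫ φ in (0:ℝ)..(2*π), Ψ φ θ * cos φ with hmc
  set ms : ℝ → ℝ := fun θ => ∫ φ in (0:ℝ)..(2*π), Ψ φ θ * sin φ with hms
  set m0' : ℝ → ℝ := fun θ => ∫ φ in (0:ℝ)..(2*π), Ψθ φ θ with hm0'
  set mc' : ℝ → ℝ := fun θ => ∫ φ in (0:ℝ)..(2*π), Ψθ φ θ * cos φ with hmc'
  set ms' : ℝ → ℝ := fun θ => ∫ φ in (0:ℝ)..(2*π), Ψθ φ θ * sin φ with hms'
  set γc : ℝ → ℝ := fun θ => -∫ φ in (0:ℝ)..(2*π), G φ θ * sin φ with hγc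
  set γs : ℝ → ℝ := fun θ => ∫ φ in (0:ℝ)..(2*π), G φ θ * cos φ with hγs
  set N : ℝ → ℝ := fun θ => ∫ φ in (0:ℝ)..(2*π), Ψ φ θ ^ 2 with hN
  set N' : ℝ → ℝ := fun θ => ∫ φ in (0:ℝ)..(2*π), 2 * (Ψ φ θ * Ψθ φ θ) with hN'
  set D : ℝ → ℝ := fun θ => ∫ φ in (0:ℝ)..(2*π), Ψθ φ θ ^ 2 with hD
  set K : ℝ → ℝ := fun θ => ∫ φ in (0:ℝ)..(2*π), G φ θ ^ 2 with hK
  have cm0' : Continuous m0' := by fun_prop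
  have cmc' : Continuous mc' := by fun_prop
  have cms' : Continuous ms' := by fun_prop
  have cγc : Continuous γc := by fun_prop
  have cγs : Continuous γs := by fun_prop
  have cN : Continuous N := by fun_prop
  have cD : Continuous D := by fun_prop
  have cK : Continuous K := by fun_prop
  have dm0 : ∀ t, HasDerivAt m0 (m0' t) t := fun t =>
    hasDerivAt_intervalIntegral_of_continuous Ψ Ψθ hΨ hΨθ hdθ _ _ t
  have dmc : ∀ t, HasDerivAt mc (mc' t) t := fun t =>
    hasDerivAt_intervalIntegral_of_continuous (fun φ θ => Ψ φ θ * cos φ)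
      (fun φ θ => Ψθ φ θ * cos φ) (by simp only [Function.uncurry_def]; fun_prop)
      (by simp only [Function.uncurry_def]; fun_prop) (fun φ θ => (hdθ φ θ).mul_const _) _ _ t
  have dms : ∀ t, HasDerivAt ms (ms' t) t := fun t =>
    hasDerivAt_intervalIntegral_of_continuous (fun φ θ => Ψ φ θ * sin φ)
      (fun φ θ => Ψθ φ θ * sin φ) (by simp only [Function.uncurry_def]; fun_prop)
      (by simp only [Function.uncurry_def]; fun_prop) (fun φ θ => (hdθ φ θ).mul_const _) _ _ t
  have dN : ∀ t, HasDerivAt N (N' t) t := fun t =>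
    hasDerivAt_intervalIntegral_of_continuous (fun φ θ => Ψ φ θ ^ 2)
      (fun φ θ => 2 * (Ψ φ θ * Ψθ φ θ)) (by simp only [Function.uncurry_def]; fun_prop)
      (by simp only [Function.uncurry_def]; fun_prop)
      (fun φ θ => ((hdθ φ θ).pow 2).congr_deriv (by push_cast; ring)) _ _ t
  have cm0 : Continuous m0 := by fun_prop
  have cmc : Continuous mc := by fun_prop
  have cms : Continuous ms := by fun_prop
  have ec : ∀ t, mc t = cos t * γc t := by
    intro t
    simp only [hmc, hγc]
    rw [integral_mul_cos_eq _ _ (by fun_prop) (fun x => hdφ x t), mul_neg,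
      ← intervalIntegral.integral_const_mul]
    simp only [mul_assoc]
  have es : ∀ t, ms t = cos t * γs t := by
    intro t
    simp only [hms, hγs]
    rw [integral_mul_sin_eq _ _ (by fun_prop) (fun x => hdφ x t) (hper t),
      ← intervalIntegral.integral_const_mul]
    simp only [mul_assoc]
  have P0 := integral_nonneg_zonal dm0 cm0' hmean horth0
  have Pc := integral_nonneg_dipole dmc cmc' cγc ec horth1
  have Ps := integral_nonneg_dipole dms cms' cγs es horth2
  set r : ℝ → ℝ := fun t => N t - m0 t ^ 2 / (2 * π) - (mc t ^ 2 + ms t ^ 2) / π with hr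
  set r' : ℝ → ℝ := fun t => N' t - m0 t * m0' t / π
    - 2 * (mc t * mc' t + ms t * ms' t) / π with hr'
  set T : ℝ → ℝ := fun t => (D t + K t - 6 * N t) * cos t
    - (1 / (2 * π)) * (cos t * (m0' t ^ 2 - 6 * m0 t ^ 2))
    - (1 / π) * (cos t * (mc' t ^ 2 + γc t ^ 2 - 6 * mc t ^ 2))
    - (1 / π) * (cos t * (ms' t ^ 2 + γs t ^ 2 - 6 * ms t ^ 2)) with hT
  have cT : Continuous T := by fun_prop
  have dr : ∀ t, HasDerivAt r (r' t) t := by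
    intro t
    refine (((dN t).sub (((dm0 t).pow 2).div_const (2 * π))).sub
      ((((dmc t).pow 2).add ((dms t).pow 2)).div_const π)).congr_deriv ?_
    simp only [hr']
    push_cast
    field_simp
  have rpole : ∀ t, cos t = 0 → r t = 0 := by
    intro t ht
    have hconst : ∀ φ, Ψ φ t = Ψ 0 t := fun φ =>
      is_const_of_deriv_eq_zero (fun x => (hdφ x t).differentiableAt)
        (fun x => by rw [(hdφ x t).deriv, ht, zero_mul]) φ 0
    simp only [hr, ec t, es t, ht, hN, hm0]
    simp only [hconst, intervalIntegral.integral_const, smul_eq_mul]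
    field_simp
    ring
  have hTpos : 0 ≤ ∫ t in (-(π/2))..(π/2), T t := by
    have key := intervalIntegral.sub_le_integral_of_hasDeriv_right_of_le (φ := T)
      (g := fun t => -2 * (sin t * r t)) (g' := fun t => -2 * (cos t * r t + sin t * r' t))
      (by linarith : -(π/2) ≤ π/2) ?_ ?_ cT.integrableOn_Icc ?_
    · simpa [rpole (π/2) (by simp), rpole (-(π/2)) (by simp)] using key
    · exact fun t _ => (((hasDerivAt_sin t).mul (dr t)).const_mul
        (-2)).continuousAt.continuousWithinAt
    · exact fun t _ => (((hasDerivAt_sin t).mul (dr t)).const_mul (-2)).hasDerivWithinAt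
    · intro t ht
      have hc : 0 < cos t := cos_pos_of_mem_Ioo ht
      have hW := wirtinger_second (fun φ => Ψ φ t) (fun φ => cos t * G φ t) (by fun_prop)
        (fun x => hdφ x t) (hper t)
      simp only [mul_pow, intervalIntegral.integral_const_mul] at hW
      change 4 * r t ≤ cos t ^ 2 * K t - (mc t ^ 2 + ms t ^ 2) / π at hW
      have hB := bessel_first_harmonics (fun φ => Ψθ φ t + 2 * tan t * Ψ φ t) (by fun_prop)
      have hlin : ∀ e : ℝ → ℝ, Continuous e →
          ∫ φ in (0:ℝ)..(2*π), (Ψθ φ t + 2 * tan t * Ψ φ t) * e φ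
          = (∫ φ in (0:ℝ)..(2*π), Ψθ φ t * e φ)
            + 2 * tan t * ∫ φ in (0:ℝ)..(2*π), Ψ φ t * e φ := by
        intro e he
        rw [← intervalIntegral.integral_const_mul, ← intervalIntegral.integral_add]
        · simp only [add_mul, mul_assoc]
        all_goals exact Continuous.intervalIntegrable (by fun_prop) _ _
      have hlin0 := hlin (fun _ => 1) continuous_const
      simp only [mul_one] at hlin0
      have hsq : ∫ φ in (0:ℝ)..(2*π), (Ψθ φ t + 2 * tan t * Ψ φ t) ^ 2
          = D t + 2 * tan t * N' t + 4 * tan t ^ 2 * N t := by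
        simp only [hD, hN', hN]
        rw [← intervalIntegral.integral_const_mul, ← intervalIntegral.integral_const_mul,
          ← intervalIntegral.integral_add, ← intervalIntegral.integral_add]
        · congr 1; ext φ; ring
        all_goals exact Continuous.intervalIntegrable (by fun_prop) _ _
      rw [hlin _ continuous_cos, hlin _ continuous_sin, hlin0, hsq] at hB
      change 0 ≤ D t + 2 * tan t * N' t + 4 * tan t ^ 2 * N t
        - (m0' t + 2 * tan t * m0 t) ^ 2 / (2 * π)
        - ((mc' t + 2 * tan t * mc t) ^ 2 + (ms' t + 2 * tan t * ms t) ^ 2) / π at hB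
      have hcs := sin_sq_add_cos_sq t
      have hB' := mul_nonneg hc.le hB
      have hW' := mul_nonneg (inv_pos.2 hc).le (sub_nonneg.2 hW)
      refine le_of_sub_nonneg ((add_nonneg hB' hW').trans_eq ?_)
      have hs2 : sin t ^ 2 = 1 - cos t ^ 2 := by linarith
      simp only [hT, hr', tan_eq_sin_div_cos]
      rw [show 4 * r t = 4 * (N t - m0 t ^ 2 / (2 * π) - (mc t ^ 2 + ms t ^ 2) / π) from rfl,
        show r t = (N t - m0 t ^ 2 / (2 * π) - (mc t ^ 2 + ms t ^ 2) / π) from rfl]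
      simp only [ec t, es t]
      field_simp
      ring_nf
      simp only [hs2]
      ring
  have hsplit : ∀ t, (∫ φ in (0:ℝ)..(2*π), (Ψθ φ t ^ 2 + G φ t ^ 2 - 6 * Ψ φ t ^ 2)) * cos t
      = T t + (1 / (2 * π)) * (cos t * (m0' t ^ 2 - 6 * m0 t ^ 2))
      + (1 / π) * (cos t * (mc' t ^ 2 + γc t ^ 2 - 6 * mc t ^ 2))
      + (1 / π) * (cos t * (ms' t ^ 2 + γs t ^ 2 - 6 * ms t ^ 2)) := by
    intro t
    rw [intervalIntegral.integral_sub, intervalIntegral.integral_add,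
      intervalIntegral.integral_const_mul]
    · simp only [hT, hD, hK, hN]; ring
    all_goals exact Continuous.intervalIntegrable (by fun_prop) _ _
  simp_rw [hsplit]
  rw [intervalIntegral.integral_add, intervalIntegral.integral_add, intervalIntegral.integral_add,
    intervalIntegral.integral_const_mul, intervalIntegral.integral_const_mul,
    intervalIntegral.integral_const_mul]
  · positivity
  all_goals exact Continuous.intervalIntegrable (by fun_prop) _ _

lemma continuous_sphPt : Continuous fun p : ℝ × ℝ => sphPt p.1 p.2 := by
  unfold sphPt; fun_prop

/-- The derivative of `f` in the direction `v`. -/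
def sphDeriv (f : ℝ × ℝ × ℝ → ℝ) (v : ℝ × ℝ × ℝ) : ℝ × ℝ × ℝ → ℝ := fun p => fderiv ℝ f p v

/-- The `θ`-derivative of `sphRep f`. -/
def sphDerivLat (f : ℝ × ℝ × ℝ → ℝ) (φ θ : ℝ) : ℝ :=
  -sin θ * (cos φ * sphRep (sphDeriv f (1, 0, 0)) φ θ + sin φ * sphRep (sphDeriv f (0, 1, 0)) φ θ)
    + cos θ * sphRep (sphDeriv f (0, 0, 1)) φ θ

/-- The `φ`-derivative of `sphRep f`, divided by `cos θ`. -/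
def sphDerivLon (f : ℝ × ℝ × ℝ → ℝ) (φ θ : ℝ) : ℝ :=
  -sin φ * sphRep (sphDeriv f (1, 0, 0)) φ θ + cos φ * sphRep (sphDeriv f (0, 1, 0)) φ θ

section

variable {f : ℝ × ℝ × ℝ → ℝ}

lemma contDiff_sphDeriv (hf : ContDiff ℝ (⊤ : ℕ∞) f) (v : ℝ × ℝ × ℝ) :
    ContDiff ℝ (⊤ : ℕ∞) (sphDeriv f v) :=
  (hf.fderiv_right (by simp)).clm_apply contDiff_const

lemma continuous_sphRep (hf : ContDiff ℝ (⊤ : ℕ∞) f) : Continuous (sphRep f).uncurry :=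
  hf.continuous.comp continuous_sphPt

lemma continuous_sphDerivLat (hf : ContDiff ℝ (⊤ : ℕ∞) f) :
    Continuous (sphDerivLat f).uncurry := by
  have h := fun v => continuous_sphRep (contDiff_sphDeriv hf v)
  have h1 := h (1, 0, 0)
  have h2 := h (0, 1, 0)
  have h3 := h (0, 0, 1)
  unfold sphDerivLat
  simp only [Function.uncurry_def] at *
  fun_prop

lemma continuous_sphDerivLon (hf : ContDiff ℝ (⊤ : ℕ∞) f) :
    Continuous (sphDerivLon f).uncurry := by
  have h := fun v => continuous_sphRep (contDiff_sphDeriv hf v)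
  have h1 := h (1, 0, 0)
  have h2 := h (0, 1, 0)
  unfold sphDerivLon
  simp only [Function.uncurry_def] at *
  fun_prop

lemma fderiv_apply_eq_sphDeriv (p : ℝ × ℝ × ℝ) (x y z : ℝ) :
    fderiv ℝ f p (x, y, z)
      = x * sphDeriv f (1, 0, 0) p + y * sphDeriv f (0, 1, 0) p + z * sphDeriv f (0, 0, 1) p := by
  have : ((x, y, z) : ℝ × ℝ × ℝ)
      = x • ((1, 0, 0) : ℝ × ℝ × ℝ) + y • ((0, 1, 0) : ℝ × ℝ × ℝ) + z • ((0, 0, 1) : ℝ × ℝ × ℝ) := by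
    simp
  rw [this, map_add, map_add, map_smul, map_smul, map_smul]
  rfl

lemma hasDerivAt_sphRep_lat (hf : ContDiff ℝ (⊤ : ℕ∞) f) (φ θ : ℝ) :
    HasDerivAt (fun t => sphRep f φ t) (sphDerivLat f φ θ) θ := by
  have h1 : HasDerivAt (fun t => sphPt φ t) (cos φ * -sin θ, sin φ * -sin θ, cos θ) θ :=
    ((hasDerivAt_cos θ).const_mul _).prodMk
      (((hasDerivAt_cos θ).const_mul _).prodMk (hasDerivAt_sin θ))
  have h2 := (hf.differentiable (by simp) (sphPt φ θ)).hasFDerivAt.comp_hasDerivAt θ h1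
  refine h2.congr_deriv ?_
  rw [fderiv_apply_eq_sphDeriv]
  simp only [sphDerivLat, sphRep]
  ring

lemma hasDerivAt_sphRep_lon (hf : ContDiff ℝ (⊤ : ℕ∞) f) (φ θ : ℝ) :
    HasDerivAt (fun x => sphRep f x θ) (cos θ * sphDerivLon f φ θ) φ := by
  have h1 : HasDerivAt (fun x => sphPt x θ) (-sin φ * cos θ, cos φ * cos θ, 0) φ :=
    ((hasDerivAt_cos φ).mul_const _).prodMk
      (((hasDerivAt_sin φ).mul_const _).prodMk (hasDerivAt_const φ _))
  have h2 := (hf.differentiable (by simp) (sphPt φ θ)).hasFDerivAt.comp_hasDerivAt φ h1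
  refine h2.congr_deriv ?_
  rw [fderiv_apply_eq_sphDeriv]
  simp only [sphDerivLon, sphRep]
  ring

lemma sphRep_two_pi (φ θ : ℝ) : sphRep f (φ + 2 * π) θ = sphRep f φ θ := by
  simp [sphRep, sphPt]

/-- The second `θ`-derivative of `sphRep f`. -/
def sphDerivLat₂ (f : ℝ × ℝ × ℝ → ℝ) (φ θ : ℝ) : ℝ :=
  -cos θ * (cos φ * sphRep (sphDeriv f (1, 0, 0)) φ θ + sin φ * sphRep (sphDeriv f (0, 1, 0)) φ θ)
    - sin θ * (cos φ * sphDerivLat (sphDeriv f (1, 0, 0)) φ θ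
      + sin φ * sphDerivLat (sphDeriv f (0, 1, 0)) φ θ)
    - sin θ * sphRep (sphDeriv f (0, 0, 1)) φ θ + cos θ * sphDerivLat (sphDeriv f (0, 0, 1)) φ θ

/-- The second-order part of the `φ`-derivative of `sphDerivLon f`, divided by `cos θ`. -/
def sphDerivLon₂ (f : ℝ × ℝ × ℝ → ℝ) (φ θ : ℝ) : ℝ :=
  -sin φ * sphDerivLon (sphDeriv f (1, 0, 0)) φ θ + cos φ * sphDerivLon (sphDeriv f (0, 1, 0)) φ θ

/-- A continuous function agreeing with `LB (sphRep f)` away from the poles. -/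
def sphLaplacian (f : ℝ × ℝ × ℝ → ℝ) (φ θ : ℝ) : ℝ :=
  sphDerivLat₂ f φ θ - sin θ * sphRep (sphDeriv f (0, 0, 1)) φ θ + sphDerivLon₂ f φ θ
    - cos θ * (cos φ * sphRep (sphDeriv f (1, 0, 0)) φ θ
      + sin φ * sphRep (sphDeriv f (0, 1, 0)) φ θ)

lemma hasDerivAt_sphDerivLat (hf : ContDiff ℝ (⊤ : ℕ∞) f) (φ θ : ℝ) :
    HasDerivAt (fun t => sphDerivLat f φ t) (sphDerivLat₂ f φ θ) θ := by
  have h := fun v => hasDerivAt_sphRep_lat (contDiff_sphDeriv hf v) φ θ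
  refine (((hasDerivAt_sin θ).neg.mul (((h (1, 0, 0)).const_mul (cos φ)).add
    ((h (0, 1, 0)).const_mul (sin φ)))).add
    ((hasDerivAt_cos θ).mul (h (0, 0, 1)))).congr_deriv ?_
  simp only [sphDerivLat₂, Pi.add_apply, Pi.neg_apply]
  ring

lemma hasDerivAt_sphDerivLon (hf : ContDiff ℝ (⊤ : ℕ∞) f) (φ θ : ℝ) :
    HasDerivAt (fun x => sphDerivLon f x θ)
      (cos θ * sphDerivLon₂ f φ θ - (cos φ * sphRep (sphDeriv f (1, 0, 0)) φ θ
        + sin φ * sphRep (sphDeriv f (0, 1, 0)) φ θ)) φ := by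
  have h := fun v => hasDerivAt_sphRep_lon (contDiff_sphDeriv hf v) φ θ
  refine (((hasDerivAt_sin φ).neg.mul (h (1, 0, 0))).add
    ((hasDerivAt_cos φ).mul (h (0, 1, 0)))).congr_deriv ?_
  simp only [sphDerivLon₂, Pi.neg_apply]
  ring

lemma continuous_sphDerivLat₂ (hf : ContDiff ℝ (⊤ : ℕ∞) f) :
    Continuous (sphDerivLat₂ f).uncurry := by
  have h := fun v => continuous_sphRep (contDiff_sphDeriv hf v)
  have h' := fun v => continuous_sphDerivLat (contDiff_sphDeriv hf v)
  have h1 := h (1, 0, 0)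
  have h2 := h (0, 1, 0)
  have h3 := h (0, 0, 1)
  have h4 := h' (1, 0, 0)
  have h5 := h' (0, 1, 0)
  have h6 := h' (0, 0, 1)
  unfold sphDerivLat₂
  simp only [Function.uncurry_def] at *
  fun_prop

lemma continuous_sphDerivLon₂ (hf : ContDiff ℝ (⊤ : ℕ∞) f) :
    Continuous (sphDerivLon₂ f).uncurry := by
  have h := fun v => continuous_sphDerivLon (contDiff_sphDeriv hf v)
  have h1 := h (1, 0, 0)
  have h2 := h (0, 1, 0)
  unfold sphDerivLon₂
  simp only [Function.uncurry_def] at *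
  fun_prop

lemma continuous_sphLaplacian (hf : ContDiff ℝ (⊤ : ℕ∞) f) :
    Continuous (sphLaplacian f).uncurry := by
  have h := fun v => continuous_sphRep (contDiff_sphDeriv hf v)
  have h1 := h (1, 0, 0)
  have h2 := h (0, 1, 0)
  have h3 := h (0, 0, 1)
  have h4 := continuous_sphDerivLat₂ hf
  have h5 := continuous_sphDerivLon₂ hf
  unfold sphLaplacian
  simp only [Function.uncurry_def] at *
  fun_prop

lemma LB_sphRep_eq (hf : ContDiff ℝ (⊤ : ℕ∞) f) (φ θ : ℝ) (hθ : cos θ ≠ 0) :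
    LB (sphRep f) φ θ = sphLaplacian f φ θ := by
  have e1 : deriv (fun t => sphRep f φ t) = fun t => sphDerivLat f φ t :=
    funext fun t => (hasDerivAt_sphRep_lat hf φ t).deriv
  have e2 : deriv (fun x => sphRep f x θ) = fun x => cos θ * sphDerivLon f x θ :=
    funext fun x => (hasDerivAt_sphRep_lon hf x θ).deriv
  rw [LB, iteratedDeriv_succ, iteratedDeriv_one, iteratedDeriv_succ, iteratedDeriv_one, e1, e2,
    (hasDerivAt_sphDerivLat hf φ θ).deriv,
    ((hasDerivAt_sphDerivLon hf φ θ).const_mul (cos θ)).deriv, tan_eq_sin_div_cos]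
  simp only [sphLaplacian, sphDerivLat]
  have hs2 : sin θ ^ 2 = 1 - cos θ ^ 2 := by linarith [sin_sq_add_cos_sq θ]
  field_simp
  ring_nf
  simp only [hs2]
  ring

lemma integral_sphRep_mul_sphLaplacian (hf : ContDiff ℝ (⊤ : ℕ∞) f) :
    (∫ φ in (0:ℝ)..(2*π), ∫ θ in (-(π/2))..(π/2),
        sphRep f φ θ * sphLaplacian f φ θ * cos θ)
      = -∫ φ in (0:ℝ)..(2*π), ∫ θ in (-(π/2))..(π/2),
        (sphDerivLat f φ θ ^ 2 + sphDerivLon f φ θ ^ 2) * cos θ := by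
  have c0 := continuous_sphRep hf
  have c1 := continuous_sphDerivLat hf
  have c2 := continuous_sphDerivLon hf
  have c3 := continuous_sphDerivLat₂ hf
  have c4 := continuous_sphLaplacian hf
  -- `U` and `V` are the latitude and longitude parts of the divergence of `Ψ ∇Ψ`.
  set U : ℝ → ℝ → ℝ := fun φ θ => sphDerivLat f φ θ ^ 2 * cos θ
    + sphRep f φ θ * (sphDerivLat₂ f φ θ * cos θ - sphDerivLat f φ θ * sin θ) with hU
  set V : ℝ → ℝ → ℝ := fun φ θ => (sphRep f φ θ * sphLaplacian f φ θ
    + sphDerivLat f φ θ ^ 2 + sphDerivLon f φ θ ^ 2) * cos θ - U φ θ with hV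
  have cU : Continuous U.uncurry := by
    simp only [hU, Function.uncurry_def] at *; fun_prop
  have cV : Continuous V.uncurry := by
    simp only [hV, Function.uncurry_def] at *; fun_prop
  have iU : ∀ φ, ∫ θ in (-(π/2))..(π/2), U φ θ = 0 := by
    intro φ
    have hd : ∀ θ, HasDerivAt (fun θ => sphRep f φ θ * sphDerivLat f φ θ * cos θ) (U φ θ) θ := by
      intro θ
      refine (((hasDerivAt_sphRep_lat hf φ θ).mul (hasDerivAt_sphDerivLat hf φ θ)).mul
        (hasDerivAt_cos θ)).congr_deriv ?_
      simp only [hU, Pi.mul_apply]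
      ring
    rw [intervalIntegral.integral_eq_sub_of_hasDerivAt (fun θ _ => hd θ)
      (Continuous.intervalIntegrable (by fun_prop) _ _)]
    simp
  have iV : ∀ θ, ∫ φ in (0:ℝ)..(2*π), V φ θ = 0 := by
    intro θ
    have hd : ∀ φ, HasDerivAt (fun φ => sphRep f φ θ * sphDerivLon f φ θ) (V φ θ) φ := by
      intro φ
      refine ((hasDerivAt_sphRep_lon hf φ θ).mul (hasDerivAt_sphDerivLon hf φ θ)).congr_deriv ?_
      simp only [hV, hU, sphLaplacian]
      rw [show sphDerivLat f φ θ * sin θ = _ from congrArg (· * sin θ) (sphDerivLat.eq_1 f φ θ)]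
      have hs2 : sin θ ^ 2 = 1 - cos θ ^ 2 := by linarith [sin_sq_add_cos_sq θ]
      ring_nf
      simp only [hs2]
      ring
    rw [intervalIntegral.integral_eq_sub_of_hasDerivAt (fun φ _ => hd φ)
      (Continuous.intervalIntegrable (by fun_prop) _ _)]
    have h := fun g : ℝ × ℝ × ℝ → ℝ => sphRep_two_pi (f := g) 0 θ
    simp only [zero_add] at h
    simp [sphDerivLon, h]
  have hsum : ∫ φ in (0:ℝ)..(2*π), ∫ θ in (-(π/2))..(π/2), (U φ θ + V φ θ) = 0 := by
    have : ∀ φ, ∫ θ in (-(π/2))..(π/2), (U φ θ + V φ θ) = ∫ θ in (-(π/2))..(π/2), V φ θ := by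
      intro φ
      rw [intervalIntegral.integral_add (Continuous.intervalIntegrable (by fun_prop) _ _)
        (Continuous.intervalIntegrable (by fun_prop) _ _), iU, zero_add]
    simp_rw [this]
    rw [intervalIntegral_swap_of_continuous _ cV]
    simp [iV]
  have hUV : ∀ φ θ, U φ θ + V φ θ = sphRep f φ θ * sphLaplacian f φ θ * cos θ
      + (sphDerivLat f φ θ ^ 2 + sphDerivLon f φ θ ^ 2) * cos θ := by
    intro φ θ; simp only [hV]; ring
  simp_rw [hUV] at hsum
  rw [eq_neg_iff_add_eq_zero, ← intervalIntegral.integral_add, ← hsum]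
  · congr 1; ext φ
    rw [intervalIntegral.integral_add] <;>
      exact Continuous.intervalIntegrable (by fun_prop) _ _
  all_goals
    apply Continuous.intervalIntegrable
    apply intervalIntegral.continuous_parametric_intervalIntegral_of_continuous'
    simp only [Function.uncurry_def] at *
    fun_prop

end

/-- Sharp Poincaré inequality on the sphere for functions orthogonal to the constants and to
the first eigenspace of the Laplace–Beltrami operator: the squared `L²` norm of the vorticity
`ΔΨ` is at least `6` times the squared `L²` norm of the velocity. -/
theorem poincare_sphere_second (ψ : ℝ × ℝ × ℝ → ℝ)
    (hψ : ContDiff ℝ (⊤ : ℕ∞) ψ)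
    (hmean : (∫ φ in (0:ℝ)..(2*π), ∫ θ in (-(π/2))..(π/2),
        sphRep ψ φ θ * Real.cos θ) = 0)
    (horth0 : (∫ φ in (0:ℝ)..(2*π), ∫ θ in (-(π/2))..(π/2),
        sphRep ψ φ θ * Real.sin θ * Real.cos θ) = 0)
    (horth1 : (∫ φ in (0:ℝ)..(2*π), ∫ θ in (-(π/2))..(π/2),
        sphRep ψ φ θ * Real.cos φ * Real.cos θ ^ 2) = 0)
    (horth2 : (∫ φ in (0:ℝ)..(2*π), ∫ θ in (-(π/2))..(π/2),
        sphRep ψ φ θ * Real.sin φ * Real.cos θ ^ 2) = 0) :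
    (∫ φ in (0:ℝ)..(2*π), ∫ θ in (-(π/2))..(π/2),
        (LB (sphRep ψ) φ θ) ^ 2 * Real.cos θ)
      ≥ 6 * ∫ φ in (0:ℝ)..(2*π), ∫ θ in (-(π/2))..(π/2),
          ((deriv (fun θ' => sphRep ψ φ θ') θ) ^ 2
            + (deriv (fun φ' => sphRep ψ φ' θ) φ) ^ 2 / Real.cos θ ^ 2) * Real.cos θ := by
  have c0 := continuous_sphRep hψ
  have c1 := continuous_sphDerivLat hψ
  have c2 := continuous_sphDerivLon hψ
  have c4 := continuous_sphLaplacian hψ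
  have hL : ∀ φ θ, LB (sphRep ψ) φ θ ^ 2 * cos θ = sphLaplacian ψ φ θ ^ 2 * cos θ := by
    intro φ θ
    by_cases h : cos θ = 0
    · simp [h]
    · rw [LB_sphRep_eq hψ φ θ h]
  have hE : ∀ φ θ, ((deriv (fun θ' => sphRep ψ φ θ') θ) ^ 2
      + (deriv (fun φ' => sphRep ψ φ' θ) φ) ^ 2 / cos θ ^ 2) * cos θ
      = (sphDerivLat ψ φ θ ^ 2 + sphDerivLon ψ φ θ ^ 2) * cos θ := by
    intro φ θ
    rw [(hasDerivAt_sphRep_lat hψ φ θ).deriv, (hasDerivAt_sphRep_lon hψ φ θ).deriv]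
    by_cases h : cos θ = 0
    · simp [h]
    · field_simp
  simp_rw [hL, hE]
  have hP := poincare_sphere_coordinates (sphRep ψ) (sphDerivLat ψ) (sphDerivLon ψ) c0 c1 c2
    (hasDerivAt_sphRep_lat hψ) (hasDerivAt_sphRep_lon hψ)
    (fun θ => by simpa using (sphRep_two_pi (f := ψ) 0 θ).symm) hmean horth0 horth1 horth2
  have hI := integral_sphRep_mul_sphLaplacian hψ
  have hnn : 0 ≤ ∫ φ in (0:ℝ)..(2*π), ∫ θ in (-(π/2))..(π/2),
      (sphLaplacian ψ φ θ + 6 * sphRep ψ φ θ) ^ 2 * cos θ :=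
    intervalIntegral.integral_nonneg (by positivity) fun φ _ =>
      intervalIntegral.integral_nonneg (by linarith [pi_pos]) fun θ hθ =>
        mul_nonneg (sq_nonneg _) (cos_nonneg_of_mem_Icc hθ)
  have hadd : ∀ F H : ℝ → ℝ → ℝ, Continuous F.uncurry → Continuous H.uncurry → ∀ c : ℝ,
      ∫ φ in (0:ℝ)..(2*π), ∫ θ in (-(π/2))..(π/2), (F φ θ + c * H φ θ)
      = (∫ φ in (0:ℝ)..(2*π), ∫ θ in (-(π/2))..(π/2), F φ θ)
        + c * ∫ φ in (0:ℝ)..(2*π), ∫ θ in (-(π/2))..(π/2), H φ θ := by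
    intro F H hF hH c
    rw [← intervalIntegral.integral_const_mul, ← intervalIntegral.integral_add]
    · congr 1; ext φ
      rw [← intervalIntegral.integral_const_mul, ← intervalIntegral.integral_add] <;>
        exact Continuous.intervalIntegrable (by fun_prop) _ _
    all_goals exact Continuous.intervalIntegrable (by fun_prop) _ _
  have hexp := hadd (fun φ θ => sphLaplacian ψ φ θ ^ 2 * cos θ
      + 12 * (sphRep ψ φ θ * sphLaplacian ψ φ θ * cos θ))
    (fun φ θ => sphRep ψ φ θ ^ 2 * cos θ) (by simp only [Function.uncurry_def] at *; fun_prop)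
    (by simp only [Function.uncurry_def] at *; fun_prop) 36
  have hcross := hadd (fun φ θ => sphLaplacian ψ φ θ ^ 2 * cos θ)
    (fun φ θ => sphRep ψ φ θ * sphLaplacian ψ φ θ * cos θ)
    (by simp only [Function.uncurry_def] at *; fun_prop)
    (by simp only [Function.uncurry_def] at *; fun_prop) 12
  rw [hI] at hcross
  have hexp' := hadd (fun φ θ => (sphDerivLat ψ φ θ ^ 2 + sphDerivLon ψ φ θ ^ 2) * cos θ)
    (fun φ θ => sphRep ψ φ θ ^ 2 * cos θ) (by simp only [Function.uncurry_def] at *; fun_prop)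
    (by simp only [Function.uncurry_def] at *; fun_prop) (-6)
  have e1 : ∀ φ θ, (sphLaplacian ψ φ θ + 6 * sphRep ψ φ θ) ^ 2 * cos θ
      = sphLaplacian ψ φ θ ^ 2 * cos θ + 12 * (sphRep ψ φ θ * sphLaplacian ψ φ θ * cos θ)
        + 36 * (sphRep ψ φ θ ^ 2 * cos θ) := fun φ θ => by ring
  have e2 : ∀ φ θ, (sphDerivLat ψ φ θ ^ 2 + sphDerivLon ψ φ θ ^ 2 - 6 * sphRep ψ φ θ ^ 2) * cos θ
      = (sphDerivLat ψ φ θ ^ 2 + sphDerivLon ψ φ θ ^ 2) * cos θ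
        + -6 * (sphRep ψ φ θ ^ 2 * cos θ) := fun φ θ => by ring
  simp_rw [e1] at hnn
  simp_rw [e2] at hP
  linarith
end
end

section
/- Let F : ℝ → ℝ be continuous and let f : (−1,1) → ℝ be twice differentiable with (1−s²) f''(s) − 2s f'(s) = F(f(s)) for all s ∈ (−1,1), i.e. the zonal function with representation f(sin θ) solves the stationary Euler equation ΔΨ = F(Ψ). Then for every φ₀ ∈ ℝ, the (in general non-zonal) function Ψ(φ,θ) := f(cos θ sin(φ − φ₀)) satisfies (ΔΨ)(φ,θ) = F(Ψ(φ,θ)) at every point (φ,θ) with θ ∈ (−π/2, π/2) and |cos θ sin(φ − φ₀)| < 1. -/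
open Real MeasureTheory

noncomputable section

/-- Second-order chain rule for real functions of one variable. -/
theorem iteratedDeriv_two_comp {f g g' : ℝ → ℝ} {x g'' : ℝ}
    (hf : ∀ᶠ y in nhds (g x), DifferentiableAt ℝ f y)
    (hf' : DifferentiableAt ℝ (deriv f) (g x))
    (hg : ∀ y, HasDerivAt g (g' y) y) (hg' : HasDerivAt g' g'' x) :
    iteratedDeriv 2 (fun y => f (g y)) x
      = deriv (deriv f) (g x) * g' x ^ 2 + deriv f (g x) * g'' := by
  have hderiv : deriv (fun y => f (g y)) =ᶠ[nhds x] fun y => deriv f (g y) * g' y := by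
    filter_upwards [(hg x).continuousAt.eventually hf] with y hy
    exact (hy.hasDerivAt.comp y (hg y)).deriv
  rw [iteratedDeriv_succ, iteratedDeriv_one, hderiv.deriv_eq]
  have h : HasDerivAt (fun y => deriv f (g y) * g' y) _ x :=
    (hf'.hasDerivAt.comp x (hg x)).mul hg'
  rw [h.deriv]
  simp only [Function.comp_apply]
  ring

/-- Symmetry-generated non-zonal solutions: if the zonal profile `f(sin θ)` solves
`ΔΨ = F(Ψ)`, i.e. `(1−s²) f'' − 2s f' = F(f)` on `(−1,1)`, then for every `φ₀` the rotated
function `Ψ(φ,θ) = f(cos θ sin(φ−φ₀))` also solves `ΔΨ = F(Ψ)`. -/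
theorem rotated_zonal_solution (F : ℝ → ℝ) (f : ℝ → ℝ)
    (hF : Continuous F)
    (hf1 : ∀ s ∈ Set.Ioo (-1:ℝ) 1, DifferentiableAt ℝ f s)
    (hf2 : ∀ s ∈ Set.Ioo (-1:ℝ) 1, DifferentiableAt ℝ (deriv f) s)
    (hode : ∀ s ∈ Set.Ioo (-1:ℝ) 1,
      (1 - s ^ 2) * deriv (deriv f) s - 2 * s * deriv f s = F (f s)) :
    ∀ φ₀ φ θ : ℝ, θ ∈ Set.Ioo (-(π/2)) (π/2) →
      |Real.cos θ * Real.sin (φ - φ₀)| < 1 →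
      LB (fun φ' θ' => f (Real.cos θ' * Real.sin (φ' - φ₀))) φ θ
        = F (f (Real.cos θ * Real.sin (φ - φ₀))) := by
  intro φ₀ φ θ hθ hs
  have hmem : Real.cos θ * Real.sin (φ - φ₀) ∈ Set.Ioo (-1 : ℝ) 1 := abs_lt.mp hs
  have hcos : Real.cos θ ≠ 0 := (Real.cos_pos_of_mem_Ioo hθ).ne'
  have hev : ∀ᶠ y in nhds (Real.cos θ * Real.sin (φ - φ₀)), DifferentiableAt ℝ f y :=
    Filter.eventually_of_mem (isOpen_Ioo.mem_nhds hmem) hf1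
  have hlat (y : ℝ) : HasDerivAt (fun θ' => Real.cos θ' * Real.sin (φ - φ₀))
      (-Real.sin y * Real.sin (φ - φ₀)) y :=
    (Real.hasDerivAt_cos y).mul_const _
  have hlat' : HasDerivAt (fun y => -Real.sin y * Real.sin (φ - φ₀))
      (-Real.cos θ * Real.sin (φ - φ₀)) θ :=
    (Real.hasDerivAt_sin θ).neg.mul_const _
  have hlon (y : ℝ) : HasDerivAt (fun φ' => Real.cos θ * Real.sin (φ' - φ₀))
      (Real.cos θ * Real.cos (y - φ₀)) y :=
    ((Real.hasDerivAt_sin (y - φ₀)).comp_sub_const y φ₀).const_mul _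
  have hlon' : HasDerivAt (fun y => Real.cos θ * Real.cos (y - φ₀))
      (Real.cos θ * -Real.sin (φ - φ₀)) φ :=
    ((Real.hasDerivAt_cos (φ - φ₀)).comp_sub_const φ φ₀).const_mul _
  have hderiv : deriv (fun θ' => f (Real.cos θ' * Real.sin (φ - φ₀))) θ
      = deriv f (Real.cos θ * Real.sin (φ - φ₀)) * (-Real.sin θ * Real.sin (φ - φ₀)) :=
    ((hf1 _ hmem).hasDerivAt.comp θ (hlat θ)).deriv
  simp only [LB]
  rw [iteratedDeriv_two_comp (g := fun θ' => Real.cos θ' * Real.sin (φ - φ₀))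
      hev (hf2 _ hmem) hlat hlat',
    iteratedDeriv_two_comp (g := fun φ' => Real.cos θ * Real.sin (φ' - φ₀))
      hev (hf2 _ hmem) hlon hlon', hderiv, ← hode _ hmem, Real.tan_eq_sin_div_cos]
  field_simp
  rw [Real.sin_sq θ, Real.cos_sq' (φ - φ₀)]
  ring
end
end

section
/- For every ε ∈ (0,1), the zonal function Ψ(φ,θ) = ln((1 + ε sin θ)/(1 − ε sin θ)) satisfies (ΔΨ)(φ,θ) = F(Ψ(φ,θ)) for all φ ∈ ℝ and θ ∈ (−π/2, π/2), where F(s) = −((1−ε²)/2) · (2 sinh s + sinh(2s)); i.e. it is an exact zonal stationary solution of the Euler equation on the non-rotating sphere with this nonlinearity. -/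
open Real MeasureTheory

noncomputable section

theorem one_add_mul_sin_pos {ε : ℝ} (hε : ε ∈ Set.Ioo (0 : ℝ) 1) (t : ℝ) :
    0 < 1 + ε * Real.sin t := by
  obtain ⟨h0, h1⟩ := hε
  nlinarith [Real.neg_one_le_sin t]

theorem one_sub_mul_sin_pos {ε : ℝ} (hε : ε ∈ Set.Ioo (0 : ℝ) 1) (t : ℝ) :
    0 < 1 - ε * Real.sin t := by
  obtain ⟨h0, h1⟩ := hε
  nlinarith [Real.sin_le_one t]

theorem hasDerivAt_log_one_add_div_one_sub_mul_sin {ε : ℝ} (hε : ε ∈ Set.Ioo (0 : ℝ) 1) (t : ℝ) :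
    HasDerivAt (fun t => Real.log ((1 + ε * Real.sin t) / (1 - ε * Real.sin t)))
      (2 * ε * Real.cos t / (1 - (ε * Real.sin t) ^ 2)) t := by
  have hp := (one_add_mul_sin_pos hε t).ne'
  have hm := (one_sub_mul_sin_pos hε t).ne'
  have hs := (Real.hasDerivAt_sin t).const_mul ε
  have hq : HasDerivAt (fun t => (1 + ε * Real.sin t) / (1 - ε * Real.sin t)) _ t :=
    (hs.const_add 1).div (hs.const_sub 1) hm
  refine (hq.log (div_ne_zero hp hm)).congr_deriv ?_
  rw [show 1 - (ε * Real.sin t) ^ 2 = (1 + ε * Real.sin t) * (1 - ε * Real.sin t) by ring]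
  field_simp
  ring

theorem hasDerivAt_cos_div_one_sub_mul_sin_sq {ε : ℝ} {t : ℝ}
    (hd : 1 - (ε * Real.sin t) ^ 2 ≠ 0) :
    HasDerivAt (fun t => 2 * ε * Real.cos t / (1 - (ε * Real.sin t) ^ 2))
      ((-(2 * ε * Real.sin t) * (1 - (ε * Real.sin t) ^ 2)
        + 4 * ε ^ 3 * Real.sin t * Real.cos t ^ 2) / (1 - (ε * Real.sin t) ^ 2) ^ 2) t := by
  have hs := (Real.hasDerivAt_sin t).const_mul ε
  have hq : HasDerivAt (fun t => 1 - (ε * Real.sin t) ^ 2) _ t := (hs.pow 2).const_sub 1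
  have hr : HasDerivAt (fun t => 2 * ε * Real.cos t / (1 - (ε * Real.sin t) ^ 2)) _ t :=
    ((Real.hasDerivAt_cos t).const_mul (2 * ε)).div hq hd
  refine hr.congr_deriv ?_
  congr 1
  push_cast
  ring

/-- For every `ε ∈ (0,1)`, the zonal stream function
`Ψ(φ,θ) = ln((1 + ε sin θ)/(1 − ε sin θ))` satisfies `ΔΨ = F(Ψ)` with
`F(s) = −((1−ε²)/2)·(2 sinh s + sinh(2s))`. -/
theorem explicit_zonal_solution_log (ε : ℝ) (hε : ε ∈ Set.Ioo (0:ℝ) 1) :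
    ∀ φ θ : ℝ, θ ∈ Set.Ioo (-(π/2)) (π/2) →
      LB (fun _ θ' => Real.log ((1 + ε * Real.sin θ') / (1 - ε * Real.sin θ'))) φ θ
        = -((1 - ε ^ 2) / 2) *
            (2 * Real.sinh (Real.log ((1 + ε * Real.sin θ) / (1 - ε * Real.sin θ)))
              + Real.sinh (2 * Real.log ((1 + ε * Real.sin θ) / (1 - ε * Real.sin θ)))) := by
  intro φ θ hθ
  have hp := one_add_mul_sin_pos hε θ
  have hm := one_sub_mul_sin_pos hε θ
  have hc : Real.cos θ ≠ 0 := (Real.cos_pos_of_mem_Ioo hθ).ne'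
  have hfac : 1 - (ε * Real.sin θ) ^ 2 = (1 + ε * Real.sin θ) * (1 - ε * Real.sin θ) := by ring
  have hd : 1 - (ε * Real.sin θ) ^ 2 ≠ 0 := hfac ▸ (mul_pos hp hm).ne'
  have hderiv : deriv (fun t => Real.log ((1 + ε * Real.sin t) / (1 - ε * Real.sin t)))
      = fun t => 2 * ε * Real.cos t / (1 - (ε * Real.sin t) ^ 2) :=
    funext fun t => (hasDerivAt_log_one_add_div_one_sub_mul_sin hε t).deriv
  have hφ (c : ℝ) : iteratedDeriv 2 (fun _ : ℝ => c) φ = 0 := by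
    simp [iteratedDeriv_succ, iteratedDeriv_zero]
  rw [LB, hφ, iteratedDeriv_succ, iteratedDeriv_one, hderiv,
    (hasDerivAt_cos_div_one_sub_mul_sin_sq hd).deriv, Real.sinh_two_mul,
    Real.sinh_log (div_pos hp hm), Real.cosh_log (div_pos hp hm), Real.tan_eq_sin_div_cos]
  beta_reduce
  rw [hfac]
  have hp' := hp.ne'
  have hm' := hm.ne'
  have hcs := Real.cos_sq' θ
  generalize Real.sin θ = s at *
  generalize Real.cos θ = c at *
  field_simp
  rw [hcs]
  ring
end
end

section
/- For every ε ∈ ℝ, the zonal function Ψ(φ,θ) = e^{ε sin θ} − 1 satisfies (ΔΨ)(φ,θ) = F(Ψ(φ,θ)) for all φ ∈ ℝ and θ ∈ (−π/2, π/2), where F(s) = ε²(1+s) − (1+s)·(ln(1+s))² − 2(1+s)·ln(1+s) for s > −1; i.e. it is an exact zonal stationary solution of the Euler equation on the non-rotating sphere with this nonlinearity. -/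
open Real MeasureTheory

noncomputable section

theorem deriv_exp_mul_sin_sub_one (ε : ℝ) :
    deriv (fun x => Real.exp (ε * Real.sin x) - 1) =
      fun x => Real.exp (ε * Real.sin x) * (ε * Real.cos x) := by
  funext x
  exact (((Real.hasDerivAt_sin x).const_mul ε).exp.sub_const 1).deriv

theorem iteratedDeriv_two_exp_mul_sin_sub_one (ε x : ℝ) :
    iteratedDeriv 2 (fun x => Real.exp (ε * Real.sin x) - 1) x =
      Real.exp (ε * Real.sin x) * (ε * Real.cos x) * (ε * Real.cos x)
        + Real.exp (ε * Real.sin x) * (ε * -Real.sin x) := by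
  rw [iteratedDeriv_succ, iteratedDeriv_one, deriv_exp_mul_sin_sub_one]
  exact (((Real.hasDerivAt_sin x).const_mul ε).exp.mul
    ((Real.hasDerivAt_cos x).const_mul ε)).deriv

/-- For every `ε`, the zonal stream function `Ψ(φ,θ) = e^{ε sin θ} − 1` satisfies
`ΔΨ = F(Ψ)` with `F(s) = ε²(1+s) − (1+s)(ln(1+s))² − 2(1+s) ln(1+s)`. -/
theorem explicit_zonal_solution_exp (ε : ℝ) :
    ∀ φ θ : ℝ, θ ∈ Set.Ioo (-(π/2)) (π/2) →
      LB (fun _ θ' => Real.exp (ε * Real.sin θ') - 1) φ θ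
        = ε ^ 2 * (1 + (Real.exp (ε * Real.sin θ) - 1))
          - (1 + (Real.exp (ε * Real.sin θ) - 1))
              * (Real.log (1 + (Real.exp (ε * Real.sin θ) - 1))) ^ 2
          - 2 * (1 + (Real.exp (ε * Real.sin θ) - 1))
              * Real.log (1 + (Real.exp (ε * Real.sin θ) - 1)) := by
  intro φ θ hθ
  have hcos : Real.cos θ ≠ 0 := (Real.cos_pos_of_mem_Ioo hθ).ne'
  have htan : Real.tan θ * Real.cos θ = Real.sin θ := Real.tan_mul_cos hcos
  simp only [LB, iteratedDeriv_two_exp_mul_sin_sub_one, deriv_exp_mul_sin_sub_one,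
    iteratedDeriv_const, add_sub_cancel, Real.log_exp]
  simp only [OfNat.ofNat_ne_zero, if_false, mul_zero, add_zero]
  linear_combination (-(ε * Real.exp (ε * Real.sin θ))) * htan
    + ε ^ 2 * Real.exp (ε * Real.sin θ) * Real.sin_sq_add_cos_sq θ
end
end

section
/- Let ω ∈ ℝ and let ψ₀ : ℝ × ℝ³ → ℝ be infinitely differentiable, with time-dependent spherical-coordinate representation Ψ₀(t,φ,θ). Define Ψ_ω(t,φ,θ) = Ψ₀(t, φ + ω t, θ) + ω sin θ. Then Ψ_ω satisfies the vorticity equation (E_ω) if and only if Ψ₀ satisfies the vorticity equation (E_0) on the fixed sphere. -/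
open Real MeasureTheory

noncomputable section

/-- The vorticity (Euler) equation `(E_ω)` on the sphere rotating at speed `ω`, for a
time-dependent stream function with representation `Ψ t φ θ`:
`∂t(ΔΨ) + (1/cos θ)·[∂φΨ · ∂θ(ΔΨ + 2ω sin θ) − ∂θΨ · ∂φ(ΔΨ + 2ω sin θ)] = 0`. -/
def EulerEq (ω : ℝ) (Ψ : ℝ → ℝ → ℝ → ℝ) : Prop :=
  ∀ t φ θ : ℝ, θ ∈ Set.Ioo (-(π/2)) (π/2) →
    deriv (fun t' => LB (Ψ t') φ θ) t
      + (1 / Real.cos θ) *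
        (deriv (fun φ' => Ψ t φ' θ) φ *
            deriv (fun θ' => LB (Ψ t) φ θ' + 2 * ω * Real.sin θ') θ
          - deriv (fun θ' => Ψ t φ θ') θ *
            deriv (fun φ' => LB (Ψ t) φ' θ + 2 * ω * Real.sin θ) φ) = 0

/-- The derivative of a smooth family of functions of one real variable, at a smoothly varying
point, is smooth in the parameter. -/
theorem contDiff_deriv_family {E : Type*} [NormedAddCommGroup E] [NormedSpace ℝ E]
    {f : E → ℝ → ℝ} {g : E → ℝ} (hf : ContDiff ℝ (⊤ : ℕ∞) (Function.uncurry f))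
    (hg : ContDiff ℝ (⊤ : ℕ∞) g) : ContDiff ℝ (⊤ : ℕ∞) fun x => deriv (f x) (g x) := by
  have h : ContDiff ℝ (⊤ : ℕ∞) fun x => fderiv ℝ (f x) (g x) := hf.fderiv hg (by simp)
  simpa only [fderiv_apply_one_eq_deriv] using h.clm_apply (contDiff_const (c := (1 : ℝ)))

theorem contDiff_iteratedDeriv_two_family {E : Type*} [NormedAddCommGroup E] [NormedSpace ℝ E]
    {f : E → ℝ → ℝ} {g : E → ℝ} (hf : ContDiff ℝ (⊤ : ℕ∞) (Function.uncurry f))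
    (hg : ContDiff ℝ (⊤ : ℕ∞) g) :
    ContDiff ℝ (⊤ : ℕ∞) fun x => iteratedDeriv 2 (f x) (g x) := by
  simp only [iteratedDeriv_succ, iteratedDeriv_zero]
  refine contDiff_deriv_family (f := fun x => deriv (f x)) ?_ hg
  refine contDiff_deriv_family (E := E × ℝ) (f := fun p => f p.1) (g := Prod.snd) ?_ contDiff_snd
  exact hf.comp ((contDiff_fst.comp contDiff_fst).prodMk contDiff_snd)

/-- At a fixed latitude, the Laplacian of a smooth time-dependent function is smooth in time and
longitude. -/
theorem contDiff_LB {F : ℝ → ℝ → ℝ → ℝ}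
    (hF : ContDiff ℝ (⊤ : ℕ∞) fun p : ℝ × ℝ × ℝ => F p.1 p.2.1 p.2.2) (θ : ℝ) :
    ContDiff ℝ (⊤ : ℕ∞) fun p : ℝ × ℝ => LB (F p.1) p.2 θ := by
  have hlat : ContDiff ℝ (⊤ : ℕ∞)
      (Function.uncurry fun (p : ℝ × ℝ) (θ' : ℝ) => F p.1 p.2 θ') :=
    hF.comp (f := fun q : (ℝ × ℝ) × ℝ => (q.1.1, q.1.2, q.2)) (by fun_prop)
  have hlon : ContDiff ℝ (⊤ : ℕ∞)
      (Function.uncurry fun (p : ℝ × ℝ) (φ' : ℝ) => F p.1 φ' θ) :=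
    hF.comp (f := fun q : (ℝ × ℝ) × ℝ => (q.1.1, q.2, θ)) (by fun_prop)
  exact ((contDiff_iteratedDeriv_two_family hlat contDiff_const).sub
    (contDiff_const.mul (contDiff_deriv_family hlat contDiff_const))).add
    (contDiff_const.mul (contDiff_iteratedDeriv_two_family hlon contDiff_snd))

/-- A longitude shift commutes with the Laplacian, and `sin θ` is an eigenfunction of eigenvalue
`-2`. -/
theorem LB_shift_add_sin {u : ℝ → ℝ → ℝ} (hu : ∀ φ, ContDiff ℝ (⊤ : ℕ∞) (u φ)) (ω c φ : ℝ)
    {θ : ℝ} (hθ : Real.cos θ ≠ 0) :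
    LB (fun φ' θ' => u (φ' + c) θ' + ω * Real.sin θ') φ θ
      = LB u (φ + c) θ - 2 * ω * Real.sin θ := by
  have hd : ∀ x, deriv (fun θ' => u (φ + c) θ' + ω * Real.sin θ') x
      = deriv (u (φ + c)) x + ω * Real.cos x := fun x =>
    (((hu (φ + c)).differentiable (by simp) x).hasDerivAt.add
      ((Real.hasDerivAt_sin x).const_mul ω)).deriv
  have hd2 : deriv (fun x => deriv (u (φ + c)) x + ω * Real.cos x) θ
      = deriv (deriv (u (φ + c))) θ + ω * -Real.sin θ := by
    have h : DifferentiableAt ℝ (deriv (u (φ + c))) θ := by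
      have := (hu (φ + c)).differentiable_iteratedDeriv 1 (by exact_mod_cast ENat.natCast_lt_top 1)
      simpa only [iteratedDeriv_one] using this θ
    exact (h.hasDerivAt.add ((Real.hasDerivAt_cos θ).const_mul ω)).deriv
  have hlon : iteratedDeriv 2 (fun φ' => u (φ' + c) θ + ω * Real.sin θ) φ
      = iteratedDeriv 2 (fun φ' => u φ' θ) (φ + c) := by
    simp only [iteratedDeriv_succ, iteratedDeriv_zero]
    rw [show deriv (fun φ' => u (φ' + c) θ + ω * Real.sin θ)
        = fun φ' => deriv (fun ψ => u ψ θ) (φ' + c) from funext fun x =>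
      (deriv_add_const _).trans (deriv_comp_add_const (fun ψ => u ψ θ) c x)]
    exact deriv_comp_add_const (deriv fun ψ => u ψ θ) c φ
  have htan : Real.tan θ * Real.cos θ = Real.sin θ := Real.tan_mul_cos hθ
  simp only [LB, hlon]
  simp only [iteratedDeriv_succ, iteratedDeriv_zero, funext hd, hd2]
  linear_combination (-ω) * htan

/-- The left-hand side of the vorticity equation. -/
def eulerLHS (ω : ℝ) (Ψ : ℝ → ℝ → ℝ → ℝ) (t φ θ : ℝ) : ℝ :=
  deriv (fun t' => LB (Ψ t') φ θ) t
    + (1 / Real.cos θ) *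
      (deriv (fun φ' => Ψ t φ' θ) φ *
          deriv (fun θ' => LB (Ψ t) φ θ' + 2 * ω * Real.sin θ') θ
        - deriv (fun θ' => Ψ t φ θ') θ *
          deriv (fun φ' => LB (Ψ t) φ' θ + 2 * ω * Real.sin θ) φ)

theorem eulerLHS_change_of_frame (ω : ℝ) {F : ℝ → ℝ → ℝ → ℝ}
    (hF : ContDiff ℝ (⊤ : ℕ∞) fun p : ℝ × ℝ × ℝ => F p.1 p.2.1 p.2.2) (t φ : ℝ) {θ : ℝ}
    (hθ : Real.cos θ ≠ 0) :
    eulerLHS ω (fun t φ θ => F t (φ + ω * t) θ + ω * Real.sin θ) t φ θ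
      = eulerLHS 0 F t (φ + ω * t) θ := by
  have hu : ∀ t φ, ContDiff ℝ (⊤ : ℕ∞) (F t φ) := fun t φ =>
    hF.comp (f := fun θ : ℝ => (t, φ, θ)) (by fun_prop)
  have hLB : ∀ t φ θ, Real.cos θ ≠ 0 →
      LB (fun φ' θ' => F t (φ' + ω * t) θ' + ω * Real.sin θ') φ θ
        = LB (F t) (φ + ω * t) θ - 2 * ω * Real.sin θ := fun t φ _ h =>
    LB_shift_add_sin (hu t) ω (ω * t) φ h
  have htime : deriv (fun t' => LB (F t') (φ + ω * t') θ - 2 * ω * Real.sin θ) t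
      = deriv (fun t' => LB (F t') (φ + ω * t) θ) t
        + ω * deriv (fun φ' => LB (F t) φ' θ) (φ + ω * t) := by
    have hL := ((contDiff_LB hF θ).differentiable (by simp) (t, φ + ω * t)).hasFDerivAt
    have hlin : HasDerivAt (fun s : ℝ => φ + ω * s) ω t := by
      simpa using ((hasDerivAt_id t).const_mul ω).const_add φ
    have h₁ := hL.comp_hasDerivAt t ((hasDerivAt_id t).prodMk hlin)
    have h₂ := hL.comp_hasDerivAt t ((hasDerivAt_id t).prodMk (hasDerivAt_const t (φ + ω * t)))
    have h₃ := hL.comp_hasDerivAt (φ + ω * t)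
      ((hasDerivAt_const (φ + ω * t) t).prodMk (hasDerivAt_id (φ + ω * t)))
    rw [deriv_sub_const]
    refine h₁.deriv.trans ?_
    refine Eq.trans ?_ (congrArg₂ (fun a b => a + ω * b) h₂.deriv h₃.deriv).symm
    rw [← smul_eq_mul (a := ω) (b := fderiv ℝ _ _ _), ← map_smul, ← map_add]
    simp
  have hlat : deriv (fun θ' => LB (fun φ' θ' => F t (φ' + ω * t) θ' + ω * Real.sin θ') φ θ'
        + 2 * ω * Real.sin θ') θ = deriv (fun θ' => LB (F t) (φ + ω * t) θ') θ := by
    refine Filter.EventuallyEq.deriv_eq ?_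
    filter_upwards [Real.continuous_cos.continuousAt.eventually_ne hθ] with x hx
    rw [hLB t φ x hx]
    ring
  have hlat' : deriv (fun θ' => F t (φ + ω * t) θ' + ω * Real.sin θ') θ
      = deriv (fun θ' => F t (φ + ω * t) θ') θ + ω * Real.cos θ :=
    (((hu t (φ + ω * t)).differentiable (by simp) θ).hasDerivAt.add
      ((Real.hasDerivAt_sin θ).const_mul ω)).deriv
  simp only [eulerLHS, hlat, hlat']
  simp only [hLB _ _ _ hθ, htime, sub_add_cancel, deriv_add_const, mul_zero, zero_mul, add_zero,
    deriv_comp_add_const (fun φ' => LB (F t) φ' θ), deriv_comp_add_const (fun φ' => F t φ' θ)]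
  field_simp
  ring

/-- Change-of-frame transformation: `Ψ_ω(t,φ,θ) = Ψ₀(t, φ + ωt, θ) + ω sin θ` solves the
vorticity equation `(E_ω)` if and only if `Ψ₀` solves the vorticity equation `(E_0)` on the
fixed sphere. -/
theorem change_of_frame (ω : ℝ) (ψ₀ : ℝ × (ℝ × ℝ × ℝ) → ℝ)
    (hψ : ContDiff ℝ (⊤ : ℕ∞) ψ₀) :
    EulerEq ω (fun t φ θ => ψ₀ (t, sphPt (φ + ω * t) θ) + ω * Real.sin θ)
      ↔ EulerEq 0 (fun t φ θ => ψ₀ (t, sphPt φ θ)) := by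
  have hF : ContDiff ℝ (⊤ : ℕ∞) fun p : ℝ × ℝ × ℝ => ψ₀ (p.1, sphPt p.2.1 p.2.2) := by
    unfold sphPt
    fun_prop
  have hcos : ∀ θ ∈ Set.Ioo (-(π / 2)) (π / 2), Real.cos θ ≠ 0 := fun θ hθ =>
    (Real.cos_pos_of_mem_Ioo hθ).ne'
  have key := fun t φ θ hθ => eulerLHS_change_of_frame ω
    (F := fun t φ θ => ψ₀ (t, sphPt φ θ)) hF t φ (hcos θ hθ)
  constructor
  · intro h t φ θ hθ
    have := (key t (φ - ω * t) θ hθ).symm.trans (h t (φ - ω * t) θ hθ)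
    rwa [sub_add_cancel] at this
  · intro h t φ θ hθ
    exact (key t φ θ hθ).trans (h t (φ + ω * t) θ hθ)
end
end

section
/- Let ω ∈ ℝ, let F : ℝ → ℝ be continuously differentiable, and let ψ : ℝ × ℝ³ → ℝ be infinitely differentiable whose time-dependent spherical-coordinate representation Ψ(t,φ,θ) satisfies the vorticity equation (E_ω). Then the Casimir invariant t ↦ ∫₀^{2π} ∫_{−π/2}^{π/2} F( (ΔΨ)(t,φ,θ) + 2ω sin θ ) cos θ dθ dφ is constant in time. -/
open Real MeasureTheory

noncomputable section

/-- Differentiation under an interval integral whose integrand has a jointly continuous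
derivative in the parameter. -/
theorem hasDerivAt_intervalIntegral_of_continuous_s12 {f f' : ℝ → ℝ → ℝ} (a b : ℝ)
    (hf : Continuous fun p : ℝ × ℝ => f p.1 p.2)
    (hf' : Continuous fun p : ℝ × ℝ => f' p.1 p.2)
    (h : ∀ t x, HasDerivAt (fun s => f s x) (f' t x) t) (t : ℝ) :
    HasDerivAt (fun s => ∫ x in a..b, f s x) (∫ x in a..b, f' t x) t := by
  obtain ⟨C, hC⟩ :=
    ((isCompact_closedBall t 1).prod (isCompact_uIcc (a := a) (b := b))).exists_bound_of_continuousOn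
      hf'.continuousOn
  have hs (s : ℝ) : Continuous (f s) := hf.comp (Continuous.prodMk_right s)
  have hs' (s : ℝ) : Continuous (f' s) := hf'.comp (Continuous.prodMk_right s)
  refine (intervalIntegral.hasDerivAt_integral_of_dominated_loc_of_deriv_le
    (bound := fun _ => C) (Metric.ball_mem_nhds t one_pos)
    (Filter.Eventually.of_forall fun s => (hs s).aestronglyMeasurable)
    ((hs t).intervalIntegrable a b) (hs' t).aestronglyMeasurable ?_
    intervalIntegrable_const ?_).2
  · exact Filter.Eventually.of_forall fun x hx s hs =>
      hC (s, x) ⟨Metric.ball_subset_closedBall hs, Set.uIoc_subset_uIcc hx⟩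
  · exact Filter.Eventually.of_forall fun x _ s _ => h s x

/-- Differentiation under a double interval integral whose integrand has a jointly continuous
derivative in the parameter. -/
theorem hasDerivAt_intervalIntegral_intervalIntegral_of_continuous {f f' : ℝ → ℝ → ℝ → ℝ}
    (a b c d : ℝ) (hf : Continuous fun p : ℝ × ℝ × ℝ => f p.1 p.2.1 p.2.2)
    (hf' : Continuous fun p : ℝ × ℝ × ℝ => f' p.1 p.2.1 p.2.2)
    (h : ∀ t x y, HasDerivAt (fun s => f s x y) (f' t x y) t) (t : ℝ) :
    HasDerivAt (fun s => ∫ x in a..b, ∫ y in c..d, f s x y)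
      (∫ x in a..b, ∫ y in c..d, f' t x y) t := by
  have key {g : ℝ → ℝ → ℝ → ℝ} (hg : Continuous fun p : ℝ × ℝ × ℝ => g p.1 p.2.1 p.2.2) :
      Continuous fun p : ℝ × ℝ => ∫ y in c..d, g p.1 p.2 y :=
    intervalIntegral.continuous_parametric_intervalIntegral_of_continuous'
      (f := fun (p : ℝ × ℝ) y => g p.1 p.2 y)
      (hg.comp (g := fun p : ℝ × ℝ × ℝ => g p.1 p.2.1 p.2.2)
        (f := fun q : (ℝ × ℝ) × ℝ => (q.1.1, q.1.2, q.2)) (by fun_prop)) c d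
  refine hasDerivAt_intervalIntegral_of_continuous_s12
    (f := fun s x => ∫ y in c..d, f s x y) (f' := fun s x => ∫ y in c..d, f' s x y)
    a b (key hf) (key hf') (fun s x => ?_) t
  exact hasDerivAt_intervalIntegral_of_continuous_s12 c d
    (hf.comp (f := fun q : ℝ × ℝ => (q.1, x, q.2)) (by fun_prop))
    (hf'.comp (f := fun q : ℝ × ℝ => (q.1, x, q.2)) (by fun_prop)) (fun u y => h u x y) s

theorem DifferentiableAt.hasDerivAt_fst {A : ℝ × ℝ → ℝ} {x y : ℝ}
    (hA : DifferentiableAt ℝ A (x, y)) :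
    HasDerivAt (fun s => A (s, y)) (fderiv ℝ A (x, y) (1, 0)) x :=
  hA.hasFDerivAt.comp_hasDerivAt x ((hasDerivAt_id x).prodMk (hasDerivAt_const x y))

theorem DifferentiableAt.hasDerivAt_snd {A : ℝ × ℝ → ℝ} {x y : ℝ}
    (hA : DifferentiableAt ℝ A (x, y)) :
    HasDerivAt (fun s => A (x, s)) (fderiv ℝ A (x, y) (0, 1)) y :=
  hA.hasFDerivAt.comp_hasDerivAt y ((hasDerivAt_const y x).prodMk (hasDerivAt_id y))

/-- The Jacobian of a pair of functions on a rectangle integrates to zero if both functions are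
periodic in the first variable and the first one is constant on each horizontal side. -/
theorem integral_jacobian_eq_zero {A G : ℝ × ℝ → ℝ} (hA : ContDiff ℝ 2 A) (hG : ContDiff ℝ 1 G)
    {a b c d : ℝ} (hAper : ∀ y, A (a, y) = A (b, y)) (hGper : ∀ y, G (a, y) = G (b, y))
    (hAc : ∀ x x', A (x, c) = A (x', c)) (hAd : ∀ x x', A (x, d) = A (x', d)) :
    ∫ x in a..b, ∫ y in c..d,
      (fderiv ℝ A (x, y) (1, 0) * fderiv ℝ G (x, y) (0, 1)
        - fderiv ℝ A (x, y) (0, 1) * fderiv ℝ G (x, y) (1, 0)) = 0 := by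
  have hAd1 : Differentiable ℝ A := hA.differentiable (by norm_num)
  have hGd : Differentiable ℝ G := hG.differentiable (by norm_num)
  have hA' : ContDiff ℝ 1 (fderiv ℝ A) := hA.fderiv_right (by norm_num)
  have hG' : Continuous (fderiv ℝ G) := hG.continuous_fderiv (by norm_num)
  have hAx (v p) : HasFDerivAt (fun q => fderiv ℝ A q v) ((fderiv ℝ (fderiv ℝ A) p).flip v) p := by
    have := ((hA'.differentiable (by norm_num)) p).hasFDerivAt.clm_apply (hasFDerivAt_const v p)
    simpa using this
  have hsymm (p) : fderiv ℝ (fderiv ℝ A) p (1, 0) (0, 1) = fderiv ℝ (fderiv ℝ A) p (0, 1) (1, 0) :=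
    hA.contDiffAt.isSymmSndFDerivAt (by simp) _ _
  have hx0 {y : ℝ} (hy : ∀ x x', A (x, y) = A (x', y)) (x : ℝ) :
      fderiv ℝ A (x, y) (1, 0) = 0 :=
    (hAd1 (x, y)).hasDerivAt_fst.unique
      ((hasDerivAt_const x (A (0, y))).congr_of_eventuallyEq
        (Filter.Eventually.of_forall fun s => hy s 0))
  have hper (y : ℝ) : fderiv ℝ A (a, y) (0, 1) = fderiv ℝ A (b, y) (0, 1) :=
    (hAd1 (a, y)).hasDerivAt_snd.unique
      ((hAd1 (b, y)).hasDerivAt_snd.congr_of_eventuallyEq (Filter.Eventually.of_forall hAper))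
  have hcont : Continuous fun p : ℝ × ℝ =>
      (fderiv ℝ A p (1, 0) * fderiv ℝ G p (0, 1)
        - fderiv ℝ A p (0, 1) * fderiv ℝ G p (1, 0)) := by
    have := hA'.continuous
    fun_prop
  have hdf (p : ℝ × ℝ) := ((hAx (0, 1) p).mul (hGd p).hasFDerivAt).neg
  have hdg (p : ℝ × ℝ) := (hAx (1, 0) p).mul (hGd p).hasFDerivAt
  have hdiv (p : ℝ × ℝ) :
      fderiv ℝ A p (1, 0) * fderiv ℝ G p (0, 1) - fderiv ℝ A p (0, 1) * fderiv ℝ G p (1, 0)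
      = (-(fderiv ℝ A p (0, 1) • fderiv ℝ G p
            + G p • (fderiv ℝ (fderiv ℝ A) p).flip (0, 1))) (1, 0)
        + (fderiv ℝ A p (1, 0) • fderiv ℝ G p
            + G p • (fderiv ℝ (fderiv ℝ A) p).flip (1, 0)) (0, 1) := by
    simp [hsymm p]
    ring
  simp only [hdiv] at hcont ⊢
  rw [MeasureTheory.integral2_divergence_prod_of_hasFDerivAt _ _ _ _ a c b d
    (fun p _ => (hdf p).continuousAt.continuousWithinAt)
    (fun p _ => (hdg p).continuousAt.continuousWithinAt)
    (fun p _ => hdf p) (fun p _ => hdg p)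
    (hcont.continuousOn.integrableOn_compact (isCompact_uIcc.prod isCompact_uIcc))]
  simp [hx0 hAc, hx0 hAd, hper, hGper]

/-- The Laplace–Beltrami operator of the unit sphere applied to the spatial variables of a
function on space-time, in Cartesian coordinates. -/
def cartesianLB (g : ℝ × ℝ × ℝ × ℝ → ℝ) (p : ℝ × ℝ × ℝ × ℝ) : ℝ :=
  let e₁ : ℝ × ℝ × ℝ × ℝ := (0, 1, 0, 0)
  let e₂ : ℝ × ℝ × ℝ × ℝ := (0, 0, 1, 0)
  let e₃ : ℝ × ℝ × ℝ × ℝ := (0, 0, 0, 1)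
  let H := fderiv ℝ (fderiv ℝ g) p
  H e₁ e₁ + H e₂ e₂ + H e₃ e₃ - H (0, p.2) (0, p.2) - 2 * fderiv ℝ g p (0, p.2)

theorem ContDiff.cartesianLB {g : ℝ × ℝ × ℝ × ℝ → ℝ} (hg : ContDiff ℝ (⊤ : ℕ∞) g) :
    ContDiff ℝ (⊤ : ℕ∞) (cartesianLB g) := by
  have h1 : ContDiff ℝ (⊤ : ℕ∞) (fderiv ℝ g) := hg.fderiv_right (by simp)
  have h2 : ContDiff ℝ (⊤ : ℕ∞) (fderiv ℝ (fderiv ℝ g)) := h1.fderiv_right (by simp)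
  unfold _root_.cartesianLB
  fun_prop

theorem contDiff_sphPt {n : WithTop ℕ∞} : ContDiff ℝ n fun p : ℝ × ℝ => sphPt p.1 p.2 := by
  unfold sphPt
  exact ((Real.contDiff_cos.comp contDiff_fst).mul (Real.contDiff_cos.comp contDiff_snd)).prodMk
    (((Real.contDiff_sin.comp contDiff_fst).mul (Real.contDiff_cos.comp contDiff_snd)).prodMk
      (Real.contDiff_sin.comp contDiff_snd))

/-- The second derivative of a function along a curve. -/
theorem iteratedDeriv_two_comp_s12 {E : Type*} [NormedAddCommGroup E] [NormedSpace ℝ E] {g : E → ℝ}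
    (hg : ContDiff ℝ 2 g) {γ γ' : ℝ → E} {γ'' : E} {s : ℝ} (h1 : ∀ s, HasDerivAt γ (γ' s) s)
    (h2 : HasDerivAt γ' γ'' s) :
    iteratedDeriv 2 (fun u => g (γ u)) s
      = fderiv ℝ (fderiv ℝ g) (γ s) (γ' s) (γ' s) + fderiv ℝ g (γ s) γ'' := by
  have hd : deriv (fun u => g (γ u)) = fun u => fderiv ℝ g (γ u) (γ' u) := by
    ext u
    exact (((hg.differentiable (by norm_num)) (γ u)).hasFDerivAt.comp_hasDerivAt u (h1 u)).deriv
  have hg' : ContDiff ℝ 1 (fderiv ℝ g) := hg.fderiv_right (by norm_num)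
  rw [iteratedDeriv_succ, iteratedDeriv_one, hd]
  exact ((((hg'.differentiable (by norm_num)) (γ s)).hasFDerivAt.comp_hasDerivAt s
    (h1 s)).clm_apply h2).deriv

theorem LB_eq_cartesianLB {g : ℝ × ℝ × ℝ × ℝ → ℝ} (hg : ContDiff ℝ 2 g) (t φ : ℝ) {θ : ℝ}
    (hθ : Real.cos θ ≠ 0) :
    LB (fun φ' θ' => g (t, sphPt φ' θ')) φ θ = cartesianLB g (t, sphPt φ θ) := by
  have hlat1 (θ : ℝ) : HasDerivAt (fun u => ((t, sphPt φ u) : ℝ × ℝ × ℝ × ℝ))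
      (0, Real.cos φ * -Real.sin θ, Real.sin φ * -Real.sin θ, Real.cos θ) θ :=
    (hasDerivAt_const θ t).prodMk (((Real.hasDerivAt_cos θ).const_mul _).prodMk
      (((Real.hasDerivAt_cos θ).const_mul _).prodMk (Real.hasDerivAt_sin θ)))
  have hlat2 : HasDerivAt (fun θ => ((0, Real.cos φ * -Real.sin θ, Real.sin φ * -Real.sin θ,
      Real.cos θ) : ℝ × ℝ × ℝ × ℝ))
      (0, Real.cos φ * -Real.cos θ, Real.sin φ * -Real.cos θ, -Real.sin θ) θ :=
    (hasDerivAt_const θ 0).prodMk (((Real.hasDerivAt_sin θ).neg.const_mul _).prodMk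
      (((Real.hasDerivAt_sin θ).neg.const_mul _).prodMk (Real.hasDerivAt_cos θ)))
  have hlon1 (φ : ℝ) : HasDerivAt (fun u => ((t, sphPt u θ) : ℝ × ℝ × ℝ × ℝ))
      (0, -Real.sin φ * Real.cos θ, Real.cos φ * Real.cos θ, 0) φ :=
    (hasDerivAt_const φ t).prodMk (((Real.hasDerivAt_cos φ).mul_const _).prodMk
      (((Real.hasDerivAt_sin φ).mul_const _).prodMk (hasDerivAt_const φ _)))
  have hlon2 : HasDerivAt (fun φ => ((0, -Real.sin φ * Real.cos θ, Real.cos φ * Real.cos θ, 0) :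
      ℝ × ℝ × ℝ × ℝ)) (0, -Real.cos φ * Real.cos θ, -Real.sin φ * Real.cos θ, 0) φ :=
    (hasDerivAt_const φ 0).prodMk (((Real.hasDerivAt_sin φ).neg.mul_const _).prodMk
      (((Real.hasDerivAt_cos φ).mul_const _).prodMk (hasDerivAt_const φ 0)))
  have hd := (((hg.differentiable (by norm_num)) (t, sphPt φ θ)).hasFDerivAt.comp_hasDerivAt θ
    (hlat1 θ)).deriv
  simp only [Function.comp_def] at hd
  have hvec (a b c : ℝ) : ((0, a, b, c) : ℝ × ℝ × ℝ × ℝ)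
      = a • (0, 1, 0, 0) + b • (0, 0, 1, 0) + c • (0, 0, 0, 1) := by simp
  unfold LB cartesianLB
  rw [iteratedDeriv_two_comp_s12 hg hlat1 hlat2, iteratedDeriv_two_comp_s12 hg hlon1 hlon2, hd]
  have hp : ((0, (t, sphPt φ θ).2) : ℝ × ℝ × ℝ × ℝ)
      = (0, Real.cos φ * Real.cos θ, Real.sin φ * Real.cos θ, Real.sin θ) := rfl
  simp only [hp]
  generalize ((t, sphPt φ θ) : ℝ × ℝ × ℝ × ℝ) = p
  simp only [hvec (Real.cos φ * _), hvec (-Real.sin φ * _), hvec (-Real.cos φ * _), map_add,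
    map_smul, add_apply, smul_apply, smul_eq_mul]
  generalize fderiv ℝ g p = L
  generalize fderiv ℝ (fderiv ℝ g) p = H
  have h1 := Real.sin_sq_add_cos_sq φ
  have h2 := Real.sin_sq_add_cos_sq θ
  rw [Real.tan_eq_sin_div_cos]
  field_simp
  linear_combination
    Real.cos θ ^ 2 * (H (0, 1, 0, 0) (0, 1, 0, 0) + H (0, 0, 1, 0) (0, 0, 1, 0)) * h1
    + (Real.cos θ ^ 2 * (Real.cos φ ^ 2 * H (0, 1, 0, 0) (0, 1, 0, 0)
          + Real.sin φ ^ 2 * H (0, 0, 1, 0) (0, 0, 1, 0) + H (0, 0, 0, 1) (0, 0, 0, 1)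
          + Real.cos φ * Real.sin φ
            * (H (0, 1, 0, 0) (0, 0, 1, 0) + H (0, 0, 1, 0) (0, 1, 0, 0)))
        + Real.cos θ * (Real.cos φ * L (0, 1, 0, 0) + Real.sin φ * L (0, 0, 1, 0))) * h2

/-- Casimir invariants: along a smooth solution of the vorticity equation `(E_ω)`,
`∫∫ F(ΔΨ + 2ω sin θ) cos θ dθ dφ` is constant in time, for any `C¹` function `F`. -/
theorem casimir_invariant (ω : ℝ) (F : ℝ → ℝ) (hF : ContDiff ℝ 1 F)
    (ψ : ℝ × (ℝ × ℝ × ℝ) → ℝ) (hψ : ContDiff ℝ (⊤ : ℕ∞) ψ)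
    (hE : EulerEq ω (fun t φ θ => ψ (t, sphPt φ θ))) :
    ∀ t₁ t₂ : ℝ,
      (∫ φ in (0:ℝ)..(2*π), ∫ θ in (-(π/2))..(π/2),
          F (LB (fun φ' θ' => ψ (t₁, sphPt φ' θ')) φ θ + 2 * ω * Real.sin θ) * Real.cos θ)
      = (∫ φ in (0:ℝ)..(2*π), ∫ θ in (-(π/2))..(π/2),
          F (LB (fun φ' θ' => ψ (t₂, sphPt φ' θ')) φ θ + 2 * ω * Real.sin θ) * Real.cos θ) := by
  set Q : ℝ × ℝ × ℝ × ℝ → ℝ := fun p => cartesianLB ψ p + 2 * ω * p.2.2.2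
  have hQ : ContDiff ℝ 1 Q := by
    have : ContDiff ℝ 1 (cartesianLB ψ) := hψ.cartesianLB.of_le (by exact_mod_cast le_top)
    fun_prop
  have hψ2 : ContDiff ℝ 2 ψ := contDiff_infty.1 hψ 2
  have hQd : Differentiable ℝ Q := hQ.differentiable (by norm_num)
  have hcos {θ : ℝ} (hθ : θ ∈ Set.Ioo (-(π/2)) (π/2)) : Real.cos θ ≠ 0 :=
    (Real.cos_pos_of_mem_Ioo hθ).ne'
  have hLB (t φ) {θ} (hθ : Real.cos θ ≠ 0) :
      LB (fun φ' θ' => ψ (t, sphPt φ' θ')) φ θ + 2 * ω * Real.sin θ = Q (t, sphPt φ θ) := by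
    rw [LB_eq_cartesianLB hψ2 t φ hθ]; rfl
  have hle : -(π/2) ≤ π/2 := by linarith [Real.pi_pos]
  have hint (t : ℝ) : (∫ φ in (0:ℝ)..(2*π), ∫ θ in (-(π/2))..(π/2),
        F (LB (fun φ' θ' => ψ (t, sphPt φ' θ')) φ θ + 2 * ω * Real.sin θ) * Real.cos θ)
      = ∫ φ in (0:ℝ)..(2*π), ∫ θ in (-(π/2))..(π/2), F (Q (t, sphPt φ θ)) * Real.cos θ := by
    congr! 3 with φ
    ext θ
    by_cases hθ : Real.cos θ = 0
    · simp [hθ]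
    · simp only [hLB t φ hθ]
  have hQt (t : ℝ) (x : ℝ × ℝ × ℝ) :
      HasDerivAt (fun s => Q (s, x)) (fderiv ℝ Q (t, x) (1, 0)) t :=
    (hQd (t, x)).hasFDerivAt.comp_hasDerivAt (f := fun s => (s, x)) t
      ((hasDerivAt_id t).prodMk (hasDerivAt_const t x))
  have hderiv (t : ℝ) : HasDerivAt (fun s => ∫ φ in (0:ℝ)..(2*π), ∫ θ in (-(π/2))..(π/2),
      F (Q (s, sphPt φ θ)) * Real.cos θ) (∫ φ in (0:ℝ)..(2*π), ∫ θ in (-(π/2))..(π/2),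
      deriv F (Q (t, sphPt φ θ)) * fderiv ℝ Q (t, sphPt φ θ) (1, 0) * Real.cos θ) t := by
    have hs : Continuous fun p : ℝ × ℝ × ℝ => ((p.1, sphPt p.2.1 p.2.2) : ℝ × ℝ × ℝ × ℝ) :=
      continuous_fst.prodMk ((contDiff_sphPt (n := 0)).continuous.comp continuous_snd)
    have hF0 := hF.continuous
    have hF1 := hF.continuous_deriv (by norm_num)
    have hQ0 := hQ.continuous
    have hQ1 := hQ.continuous_fderiv (by norm_num)
    refine hasDerivAt_intervalIntegral_intervalIntegral_of_continuous
      (f := fun s φ θ => F (Q (s, sphPt φ θ)) * Real.cos θ)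
      (f' := fun t φ θ => deriv F (Q (t, sphPt φ θ)) * fderiv ℝ Q (t, sphPt φ θ) (1, 0)
        * Real.cos θ) _ _ _ _ ?_ ?_ ?_ t
    · exact ((hF0.comp hQ0).comp hs).mul (by fun_prop)
    · exact (((hF1.comp hQ0).comp hs).mul ((hQ1.comp hs).clm_apply continuous_const)).mul
        (by fun_prop)
    · exact fun t φ θ => (((hF.differentiable (by norm_num)) _).hasDerivAt.comp t
        (hQt t _)).mul_const _
  have hzero (t : ℝ) : ∫ φ in (0:ℝ)..(2*π), ∫ θ in (-(π/2))..(π/2),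
      deriv F (Q (t, sphPt φ θ)) * fderiv ℝ Q (t, sphPt φ θ) (1, 0) * Real.cos θ = 0 := by
    have hs {n : WithTop ℕ∞} : ContDiff ℝ n fun p : ℝ × ℝ => ((t, sphPt p.1 p.2) : ℝ × ℝ × ℝ × ℝ) :=
      contDiff_const.prodMk contDiff_sphPt
    set A : ℝ × ℝ → ℝ := fun p => ψ (t, sphPt p.1 p.2)
    set B : ℝ × ℝ → ℝ := fun p => Q (t, sphPt p.1 p.2)
    set G : ℝ × ℝ → ℝ := fun p => F (B p)
    have hA : ContDiff ℝ 2 A := hψ2.comp hs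
    have hB : ContDiff ℝ 1 B := hQ.comp hs
    have hG : ContDiff ℝ 1 G := hF.comp hB
    have hAd := hA.differentiable (by norm_num)
    have hBd := hB.differentiable (by norm_num)
    have hG' (p : ℝ × ℝ) : fderiv ℝ G p = deriv F (B p) • fderiv ℝ B p :=
      (((hF.differentiable (by norm_num)) _).hasDerivAt.comp_hasFDerivAt p
        (hBd p).hasFDerivAt).fderiv
    have hJ := integral_jacobian_eq_zero hA hG (a := 0) (b := 2 * π) (c := -(π/2)) (d := π/2)
      (by simp [A, sphPt]) (by simp [G, B, sphPt]) (by simp [A, sphPt]) (by simp [A, sphPt])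
    rw [← neg_eq_zero, ← intervalIntegral.integral_neg, ← hJ]
    congr! 3 with φ
    rw [← intervalIntegral.integral_neg, intervalIntegral.integral_of_le hle,
      intervalIntegral.integral_of_le hle, integral_Ioc_eq_integral_Ioo,
      integral_Ioc_eq_integral_Ioo]
    refine setIntegral_congr_fun measurableSet_Ioo fun θ hθ => ?_
    have hEq := hE t φ θ hθ
    have e1 : deriv (fun t' => LB (fun φ θ => ψ (t', sphPt φ θ)) φ θ) t
        = fderiv ℝ Q (t, sphPt φ θ) (1, 0) := by
      have : (fun t' => LB (fun φ θ => ψ (t', sphPt φ θ)) φ θ)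
          = fun t' => Q (t', sphPt φ θ) - 2 * ω * Real.sin θ := by
        ext t'; rw [← hLB t' φ (hcos hθ)]; ring
      rw [this]
      exact ((hQt t _).sub_const _).deriv
    have e2 : deriv (fun θ' => LB (fun φ θ => ψ (t, sphPt φ θ)) φ θ' + 2 * ω * Real.sin θ') θ
        = fderiv ℝ B (φ, θ) (0, 1) := by
      rw [← (hBd (φ, θ)).hasDerivAt_snd.deriv]
      refine Filter.EventuallyEq.deriv_eq ?_
      filter_upwards [isOpen_Ioo.mem_nhds hθ] with θ' hθ' using hLB t φ (hcos hθ')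
    have e3 : deriv (fun φ' => LB (fun φ θ => ψ (t, sphPt φ θ)) φ' θ + 2 * ω * Real.sin θ) φ
        = fderiv ℝ B (φ, θ) (1, 0) := by
      rw [← (hBd (φ, θ)).hasDerivAt_fst.deriv]
      exact congrArg (deriv · φ) (funext fun φ' => hLB t φ' (hcos hθ))
    have e4 : deriv (fun φ' => ψ (t, sphPt φ' θ)) φ = fderiv ℝ A (φ, θ) (1, 0) :=
      (hAd (φ, θ)).hasDerivAt_fst.deriv
    have e5 : deriv (fun θ' => ψ (t, sphPt φ θ')) θ = fderiv ℝ A (φ, θ) (0, 1) :=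
      (hAd (φ, θ)).hasDerivAt_snd.deriv
    rw [e1, e2, e3, e4, e5] at hEq
    have hc := hcos hθ
    field_simp at hEq
    simp only [hG', smul_apply, smul_eq_mul]
    change -(deriv F (B (φ, θ)) * _ * _) = _
    linear_combination (-deriv F (B (φ, θ))) * hEq
  intro t₁ t₂
  rw [hint t₁, hint t₂]
  exact is_const_of_deriv_eq_zero (fun t => (hderiv t).differentiableAt)
    (fun t => (hderiv t).deriv.trans (hzero t)) t₁ t₂
end
end

section
/- Let ψ : ℝ × ℝ³ → ℝ be infinitely differentiable whose time-dependent spherical-coordinate representation Ψ(t,φ,θ) satisfies the vorticity equation (E_0) on the fixed (non-rotating) sphere. Then the component of the vorticity along the zonal degree-one spherical harmonic, t ↦ ∫₀^{2π} ∫_{−π/2}^{π/2} (ΔΨ)(t,φ,θ) · sin θ · cos θ dθ dφ, is constant in time. -/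
open Real MeasureTheory

noncomputable section

/-- The unit vector pointing east at longitude `φ`. -/
def east (φ : ℝ) : ℝ × ℝ × ℝ := (-Real.sin φ, Real.cos φ, 0)

/-- The unit vector pointing north at longitude `φ` and latitude `θ`. -/
def north (φ θ : ℝ) : ℝ × ℝ × ℝ :=
  (-(Real.cos φ * Real.sin θ), -(Real.sin φ * Real.sin θ), Real.cos θ)

/-- The Laplace–Beltrami operator applied to the restriction of `g` to the sphere, expressed through
the ambient first and second derivatives of `g`, hence without singularity at the poles. -/
def sphLap (g : ℝ × ℝ × ℝ → ℝ) (φ θ : ℝ) : ℝ :=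
  fderiv ℝ (fderiv ℝ g) (sphPt φ θ) (north φ θ) (north φ θ)
    + fderiv ℝ (fderiv ℝ g) (sphPt φ θ) (east φ) (east φ)
    - 2 * fderiv ℝ g (sphPt φ θ) (sphPt φ θ)

theorem hasDerivAt_sphPt_lat (φ θ : ℝ) : HasDerivAt (fun s => sphPt φ s) (north φ θ) θ := by
  unfold sphPt north
  have h := ((Real.hasDerivAt_cos θ).const_mul (Real.cos φ)).prodMk
    (((Real.hasDerivAt_cos θ).const_mul (Real.sin φ)).prodMk (Real.hasDerivAt_sin θ))
  convert h using 1
  simp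

theorem hasDerivAt_sphPt_lon (φ θ : ℝ) :
    HasDerivAt (fun s => sphPt s θ) (Real.cos θ • east φ) φ := by
  unfold sphPt east
  have h := ((Real.hasDerivAt_cos φ).mul_const (Real.cos θ)).prodMk
    (((Real.hasDerivAt_sin φ).mul_const (Real.cos θ)).prodMk (hasDerivAt_const φ (Real.sin θ)))
  convert h using 1
  simp [mul_comm]

theorem hasDerivAt_north_lat (φ θ : ℝ) : HasDerivAt (fun s => north φ s) (-sphPt φ θ) θ := by
  unfold sphPt north
  have h := ((Real.hasDerivAt_sin θ).const_mul (Real.cos φ)).fun_neg.prodMk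
    (((Real.hasDerivAt_sin θ).const_mul (Real.sin φ)).fun_neg.prodMk (Real.hasDerivAt_cos θ))
  exact h

theorem hasDerivAt_north_lon (φ θ : ℝ) :
    HasDerivAt (fun s => north s θ) (-Real.sin θ • east φ) φ := by
  unfold north east
  have h := ((Real.hasDerivAt_cos φ).mul_const (Real.sin θ)).fun_neg.prodMk
    (((Real.hasDerivAt_sin φ).mul_const (Real.sin θ)).fun_neg.prodMk
      (hasDerivAt_const φ (Real.cos θ)))
  convert h using 1
  simp [mul_comm]

theorem hasDerivAt_east (φ θ : ℝ) :
    HasDerivAt east (Real.sin θ • north φ θ - Real.cos θ • sphPt φ θ) φ := by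
  unfold east north sphPt
  have h := (Real.hasDerivAt_sin φ).fun_neg.prodMk
    ((Real.hasDerivAt_cos φ).prodMk (hasDerivAt_const φ (0 : ℝ)))
  convert h using 1
  simp only [Prod.smul_mk, smul_eq_mul, Prod.mk_sub_mk, Prod.mk.injEq]
  refine ⟨?_, ?_, by ring⟩
  · linear_combination -Real.cos φ * Real.sin_sq_add_cos_sq θ
  · linear_combination -Real.sin φ * Real.sin_sq_add_cos_sq θ

section Spatial

variable {g : ℝ × ℝ × ℝ → ℝ}

theorem hasDerivAt_comp_curve (hg : ContDiff ℝ (⊤ : ℕ∞) g)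
    {x : ℝ → ℝ × ℝ × ℝ} {x' : ℝ × ℝ × ℝ} {s : ℝ} (hx : HasDerivAt x x' s) :
    HasDerivAt (fun r => g (x r)) (fderiv ℝ g (x s) x') s :=
  ((hg.differentiable (by simp)) (x s)).hasFDerivAt.comp_hasDerivAt s hx

theorem hasDerivAt_fderiv_curve (hg : ContDiff ℝ (⊤ : ℕ∞) g)
    {x v : ℝ → ℝ × ℝ × ℝ} {x' v' : ℝ × ℝ × ℝ} {s : ℝ}
    (hx : HasDerivAt x x' s) (hv : HasDerivAt v v' s) :
    HasDerivAt (fun r => fderiv ℝ g (x r) (v r))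
      (fderiv ℝ (fderiv ℝ g) (x s) x' (v s) + fderiv ℝ g (x s) v') s := by
  have h : Differentiable ℝ (fderiv ℝ g) :=
    (hg.fderiv_right (m := (⊤ : ℕ∞)) (by simp)).differentiable (by simp)
  exact ((h (x s)).hasFDerivAt.comp_hasDerivAt s hx).clm_apply hv

theorem LB_eq_sphLap (hg : ContDiff ℝ (⊤ : ℕ∞) g) (φ : ℝ) {θ : ℝ} (hθ : Real.cos θ ≠ 0) :
    LB (fun φ' θ' => g (sphPt φ' θ')) φ θ = sphLap g φ θ := by
  have h1 : deriv (fun θ' => g (sphPt φ θ')) =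
      fun θ' => fderiv ℝ g (sphPt φ θ') (north φ θ') :=
    funext fun s => (hasDerivAt_comp_curve hg (hasDerivAt_sphPt_lat φ s)).deriv
  have h2 : deriv (fun φ' => g (sphPt φ' θ)) =
      fun φ' => fderiv ℝ g (sphPt φ' θ) (Real.cos θ • east φ') :=
    funext fun s => (hasDerivAt_comp_curve hg (hasDerivAt_sphPt_lon s θ)).deriv
  have h3 := (hasDerivAt_fderiv_curve hg (hasDerivAt_sphPt_lat φ θ)
    (hasDerivAt_north_lat φ θ)).deriv
  have h4 := (hasDerivAt_fderiv_curve hg (hasDerivAt_sphPt_lon φ θ)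
    ((hasDerivAt_east φ θ).fun_const_smul (Real.cos θ))).deriv
  unfold LB sphLap
  simp only [iteratedDeriv_succ, iteratedDeriv_zero]
  rw [h2, h4, h1, h3, Real.tan_eq_sin_div_cos]
  simp only [map_smul, map_sub, map_neg, smul_eq_mul, smul_apply]
  field_simp
  ring

theorem sphLap_periodic (g : ℝ × ℝ × ℝ → ℝ) (θ : ℝ) : sphLap g (2 * π) θ = sphLap g 0 θ := by
  simp [sphLap, sphPt, north, east]

theorem integral_divergence_eq_zero {P Q : ℝ × ℝ → ℝ} (hP : ContDiff ℝ 1 P) (hQ : ContDiff ℝ 1 Q)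
    {a b c d : ℝ} (hper : ∀ θ, P (b, θ) = P (a, θ)) (hc : ∀ φ, Q (φ, c) = 0)
    (hd : ∀ φ, Q (φ, d) = 0) :
    ∫ φ in a..b, ∫ θ in c..d,
      (deriv (fun φ' => P (φ', θ)) φ + deriv (fun θ' => Q (φ, θ')) θ) = 0 := by
  have hPd := hP.differentiable (by simp)
  have hQd := hQ.differentiable (by simp)
  have h1 (φ θ : ℝ) : deriv (fun φ' => P (φ', θ)) φ = fderiv ℝ P (φ, θ) (1, 0) :=
    ((hPd (φ, θ)).hasFDerivAt.comp_hasDerivAt φ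
      ((hasDerivAt_id φ).prodMk (hasDerivAt_const φ θ))).deriv
  have h2 (φ θ : ℝ) : deriv (fun θ' => Q (φ, θ')) θ = fderiv ℝ Q (φ, θ) (0, 1) :=
    ((hQd (φ, θ)).hasFDerivAt.comp_hasDerivAt θ
      ((hasDerivAt_const θ φ).prodMk (hasDerivAt_id θ))).deriv
  simp only [h1, h2]
  have hPc := hP.continuous_fderiv (by simp)
  have hQc := hQ.continuous_fderiv (by simp)
  rw [integral2_divergence_prod_of_hasFDerivAt P Q (fderiv ℝ P) (fderiv ℝ Q) a c b d
    hP.continuous.continuousOn hQ.continuous.continuousOn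
    (fun x _ => (hPd x).hasFDerivAt) (fun x _ => (hQd x).hasFDerivAt)]
  · simp [hper, hc, hd]
  · exact ContinuousOn.integrableOn_compact (isCompact_uIcc.prod isCompact_uIcc)
      (by fun_prop)

theorem contDiff_sphPt_s13 : ContDiff ℝ (⊤ : ℕ∞) fun q : ℝ × ℝ => sphPt q.1 q.2 := by
  unfold sphPt; fun_prop

theorem contDiff_north : ContDiff ℝ (⊤ : ℕ∞) fun q : ℝ × ℝ => north q.1 q.2 := by
  unfold north; fun_prop

theorem contDiff_east : ContDiff ℝ (⊤ : ℕ∞) east := by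
  unfold east; fun_prop

/-- Joint smoothness of the Laplacian of a smooth family of functions. -/
theorem contDiff_sphLap {ψ : ℝ × (ℝ × ℝ × ℝ) → ℝ} (hψ : ContDiff ℝ (⊤ : ℕ∞) ψ) :
    ContDiff ℝ (⊤ : ℕ∞) fun q : ℝ × ℝ × ℝ => sphLap (fun x => ψ (q.1, x)) q.2.1 q.2.2 := by
  have hD : ContDiff ℝ (⊤ : ℕ∞) fun p : ℝ × (ℝ × ℝ × ℝ) =>
      fderiv ℝ (fun x => ψ (p.1, x)) p.2 :=
    ContDiff.fderiv (f := fun (p : ℝ × (ℝ × ℝ × ℝ)) x => ψ (p.1, x)) (m := (⊤ : ℕ∞))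
      (by fun_prop) contDiff_snd (by simp)
  have hH : ContDiff ℝ (⊤ : ℕ∞) fun p : ℝ × (ℝ × ℝ × ℝ) =>
      fderiv ℝ (fderiv ℝ (fun x => ψ (p.1, x))) p.2 :=
    ContDiff.fderiv (f := fun (p : ℝ × (ℝ × ℝ × ℝ)) x => fderiv ℝ (fun x => ψ (p.1, x)) x)
      (m := (⊤ : ℕ∞))
      (hD.comp (contDiff_fst.fst.prodMk contDiff_snd)) contDiff_snd (by simp)
  have hX := contDiff_sphPt_s13.comp (contDiff_snd (𝕜 := ℝ) (E := ℝ) (F := ℝ × ℝ))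
  have hN := contDiff_north.comp (contDiff_snd (𝕜 := ℝ) (E := ℝ) (F := ℝ × ℝ))
  have hE := contDiff_east.comp (contDiff_snd (𝕜 := ℝ) (E := ℝ) (F := ℝ × ℝ)).fst
  have hDX := hD.comp (contDiff_fst.prodMk hX)
  have hHX := hH.comp (contDiff_fst.prodMk hX)
  exact (((hHX.clm_apply hN).clm_apply hN).add ((hHX.clm_apply hE).clm_apply hE)).sub
    (contDiff_const.mul (hDX.clm_apply hX))

/-- The Jacobian of `Ψ` and `ΔΨ` is orthogonal to `sin θ`. -/
theorem integral_sin_mul_jacobian_eq_zero (hg : ContDiff ℝ (⊤ : ℕ∞) g) :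
    ∫ φ in (0 : ℝ)..(2 * π), ∫ θ in (-(π / 2))..(π / 2),
      Real.sin θ * (deriv (fun φ' => g (sphPt φ' θ)) φ * deriv (fun θ' => sphLap g φ θ') θ
        - deriv (fun θ' => g (sphPt φ θ')) θ * deriv (fun φ' => sphLap g φ' θ) φ) = 0 := by
  have hL : ContDiff ℝ (⊤ : ℕ∞) fun q : ℝ × ℝ => sphLap g q.1 q.2 := by
    have h : ContDiff ℝ (⊤ : ℕ∞) fun q : ℝ × ℝ × ℝ => sphLap g q.2.1 q.2.2 :=
      contDiff_sphLap (ψ := fun p => g p.2) (by fun_prop)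
    have hi : ContDiff ℝ (⊤ : ℕ∞) fun q : ℝ × ℝ => ((0 : ℝ), q) := by fun_prop
    have hc := h.comp hi
    exact hc
  have hD : ContDiff ℝ (⊤ : ℕ∞) fun q : ℝ × ℝ => fderiv ℝ g (sphPt q.1 q.2) :=
    (hg.fderiv_right (by simp)).comp contDiff_sphPt_s13
  have hA : ContDiff ℝ (⊤ : ℕ∞) fun q : ℝ × ℝ => fderiv ℝ g (sphPt q.1 q.2) (east q.1) :=
    hD.clm_apply (contDiff_east.comp contDiff_fst)
  have hB : ContDiff ℝ (⊤ : ℕ∞) fun q : ℝ × ℝ => fderiv ℝ g (sphPt q.1 q.2) (north q.1 q.2) :=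
    hD.clm_apply contDiff_north
  have key := integral_divergence_eq_zero (a := 0) (b := 2 * π) (c := -(π / 2)) (d := π / 2)
    (P := fun q => -(Real.sin q.2 * (sphLap g q.1 q.2 * fderiv ℝ g (sphPt q.1 q.2) (north q.1 q.2)))
      + Real.cos q.2 / 2 * (fderiv ℝ g (sphPt q.1 q.2) (north q.1 q.2) ^ 2
        - fderiv ℝ g (sphPt q.1 q.2) (east q.1) ^ 2))
    (Q := fun q => Real.cos q.2 * (fderiv ℝ g (sphPt q.1 q.2) (east q.1)
      * (Real.sin q.2 * sphLap g q.1 q.2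
        - Real.cos q.2 * fderiv ℝ g (sphPt q.1 q.2) (north q.1 q.2))))
    (ContDiff.of_le (n := (⊤ : ℕ∞)) (by fun_prop) (by exact_mod_cast le_top))
    (ContDiff.of_le (n := (⊤ : ℕ∞)) (by fun_prop) (by exact_mod_cast le_top))
    (fun θ => by simp [sphLap_periodic, sphPt, north, east]) (fun φ => by simp)
    (fun φ => by simp)
  refine Eq.trans ?_ key
  refine intervalIntegral.integral_congr fun φ _ => intervalIntegral.integral_congr fun θ _ => ?_
  have hsymm : fderiv ℝ (fderiv ℝ g) (sphPt φ θ) (east φ) (north φ θ)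
      = fderiv ℝ (fderiv ℝ g) (sphPt φ θ) (north φ θ) (east φ) :=
    (hg.contDiffAt.isSymmSndFDerivAt (by
      simpa using WithTop.coe_le_coe.mpr (le_top : (2 : ℕ∞) ≤ ⊤))).eq _ _
  have hLφ : HasDerivAt (fun φ' => sphLap g φ' θ) (deriv (fun φ' => sphLap g φ' θ) φ) φ :=
    ((hL.comp (contDiff_id.prodMk contDiff_const)).differentiable (by simp) φ).hasDerivAt
  have hLθ : HasDerivAt (fun θ' => sphLap g φ θ') (deriv (fun θ' => sphLap g φ θ') θ) θ :=
    ((hL.comp (contDiff_const.prodMk contDiff_id)).differentiable (by simp) θ).hasDerivAt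
  have hBφ := hasDerivAt_fderiv_curve hg (hasDerivAt_sphPt_lon φ θ) (hasDerivAt_north_lon φ θ)
  have hAφ := hasDerivAt_fderiv_curve hg (hasDerivAt_sphPt_lon φ θ) (hasDerivAt_east φ θ)
  have hBθ := hasDerivAt_fderiv_curve hg (hasDerivAt_sphPt_lat φ θ) (hasDerivAt_north_lat φ θ)
  have hAθ := hasDerivAt_fderiv_curve hg (hasDerivAt_sphPt_lat φ θ) (hasDerivAt_const θ (east φ))
  have hPφ := ((hLφ.fun_mul hBφ).const_mul (Real.sin θ)).fun_neg.fun_add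
    (((hBφ.fun_pow 2).fun_sub (hAφ.fun_pow 2)).const_mul (Real.cos θ / 2))
  have hQθ := (Real.hasDerivAt_cos θ).fun_mul (hAθ.fun_mul
    (((Real.hasDerivAt_sin θ).fun_mul hLθ).fun_sub ((Real.hasDerivAt_cos θ).fun_mul hBθ)))
  simp only []
  rw [hPφ.deriv, hQθ.deriv, (hasDerivAt_comp_curve hg (hasDerivAt_sphPt_lat φ θ)).deriv,
    (hasDerivAt_comp_curve hg (hasDerivAt_sphPt_lon φ θ)).deriv]
  simp only [map_smul, map_sub, map_neg, map_zero, smul_eq_mul, smul_apply, hsymm]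
  generalize deriv (fun φ' => sphLap g φ' θ) φ = Lφ
  generalize deriv (fun θ' => sphLap g φ θ') θ = Lθ
  unfold sphLap
  ring

end Spatial

/-- A time-dependent double integral is constant if the double integral of its time derivative
vanishes. -/
theorem integral_integral_eq_of_integral_deriv_eq_zero {f : ℝ × ℝ × ℝ → ℝ} (hf : ContDiff ℝ 1 f)
    {a b c d : ℝ}
    (h : ∀ t, ∫ φ in a..b, ∫ θ in c..d, deriv (fun s => f (s, φ, θ)) t = 0) (t₁ t₂ : ℝ) :
    ∫ φ in a..b, ∫ θ in c..d, f (t₁, φ, θ) = ∫ φ in a..b, ∫ θ in c..d, f (t₂, φ, θ) := by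
  have hd (t φ θ : ℝ) : HasDerivAt (fun s => f (s, φ, θ)) (fderiv ℝ f (t, φ, θ) (1, 0, 0)) t :=
    (hf.differentiable (by simp) (t, φ, θ)).hasFDerivAt.comp_hasDerivAt t
      ((hasDerivAt_id t).prodMk (hasDerivAt_const t (φ, θ)))
  have hc : Continuous fun q : ℝ × ℝ × ℝ => fderiv ℝ f q (1, 0, 0) :=
    (hf.continuous_fderiv (by simp)).clm_apply continuous_const
  have swap {F : ℝ → ℝ → ℝ} (hF : Continuous F.uncurry) (a b c d : ℝ) :
      ∫ x in a..b, ∫ y in c..d, F x y = ∫ y in c..d, ∫ x in a..b, F x y :=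
    intervalIntegral_intervalIntegral_swap
      ((hF.continuousOn.integrableOn_compact (isCompact_uIcc.prod isCompact_uIcc)).mono_set
        (Set.prod_mono Set.uIoc_subset_uIcc Set.uIoc_subset_uIcc))
  simp only [(hd _ _ _).deriv] at h
  have hcf := hf.continuous
  have inner (φ : ℝ) : (∫ θ in c..d, f (t₂, φ, θ)) - ∫ θ in c..d, f (t₁, φ, θ)
      = ∫ t in t₁..t₂, ∫ θ in c..d, fderiv ℝ f (t, φ, θ) (1, 0, 0) := by
    rw [swap (F := fun t θ => fderiv ℝ f (t, φ, θ) (1, 0, 0)) (by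
        exact hc.comp (by fun_prop : Continuous fun p : ℝ × ℝ => (p.1, φ, p.2))),
      ← intervalIntegral.integral_sub]
    · refine intervalIntegral.integral_congr fun θ _ => ?_
      refine (intervalIntegral.integral_eq_sub_of_hasDerivAt (fun t _ => hd t φ θ) ?_).symm
      exact (hc.comp (by fun_prop : Continuous fun t : ℝ => (t, φ, θ))).intervalIntegrable _ _
    · exact Continuous.intervalIntegrable (by fun_prop) _ _
    · exact Continuous.intervalIntegrable (by fun_prop) _ _
  symm
  rw [← sub_eq_zero, ← intervalIntegral.integral_sub]
  · simp only [inner]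
    rw [swap]
    · simp [h]
    · refine intervalIntegral.continuous_parametric_intervalIntegral_of_continuous' ?_ _ _
      exact hc.comp (by fun_prop : Continuous fun p : (ℝ × ℝ) × ℝ => (p.1.2, p.1.1, p.2))
  · exact (intervalIntegral.continuous_parametric_intervalIntegral_of_continuous'
      (f := fun φ θ => f (t₂, φ, θ)) (by unfold Function.uncurry; fun_prop) _ _).intervalIntegrable _ _
  · exact (intervalIntegral.continuous_parametric_intervalIntegral_of_continuous'
      (f := fun φ θ => f (t₁, φ, θ)) (by unfold Function.uncurry; fun_prop) _ _).intervalIntegrable _ _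

/-- Along a smooth solution of the vorticity equation `(E_0)` on the fixed sphere, the
component of the vorticity along the zonal degree-one spherical harmonic,
`∫∫ (ΔΨ) sin θ cos θ dθ dφ`, is constant in time. -/
theorem vorticity_first_mode_conserved (ψ : ℝ × (ℝ × ℝ × ℝ) → ℝ)
    (hψ : ContDiff ℝ (⊤ : ℕ∞) ψ)
    (hE : EulerEq 0 (fun t φ θ => ψ (t, sphPt φ θ))) :
    ∀ t₁ t₂ : ℝ,
      (∫ φ in (0:ℝ)..(2*π), ∫ θ in (-(π/2))..(π/2),
          LB (fun φ' θ' => ψ (t₁, sphPt φ' θ')) φ θ * Real.sin θ * Real.cos θ)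
      = (∫ φ in (0:ℝ)..(2*π), ∫ θ in (-(π/2))..(π/2),
          LB (fun φ' θ' => ψ (t₂, sphPt φ' θ')) φ θ * Real.sin θ * Real.cos θ) := by
  have hcos {θ : ℝ} (hθ : θ ∈ Set.Ioo (-(π / 2)) (π / 2)) : Real.cos θ ≠ 0 :=
    (Real.cos_pos_of_mem_Ioo hθ).ne'
  have hle : -(π / 2) ≤ π / 2 := by linarith [Real.pi_pos]
  have hg (t : ℝ) : ContDiff ℝ (⊤ : ℕ∞) fun x => ψ (t, x) :=
    hψ.comp (contDiff_const.prodMk contDiff_id)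
  have hM (t : ℝ) : (∫ φ in (0:ℝ)..(2*π), ∫ θ in (-(π/2))..(π/2),
        LB (fun φ' θ' => ψ (t, sphPt φ' θ')) φ θ * Real.sin θ * Real.cos θ)
      = ∫ φ in (0:ℝ)..(2*π), ∫ θ in (-(π/2))..(π/2),
        sphLap (fun x => ψ (t, x)) φ θ * Real.sin θ * Real.cos θ :=
    intervalIntegral.integral_congr fun φ _ =>
      intervalIntegral.integral_congr_Ioo_of_le hle fun θ hθ => by
        simp only [LB_eq_sphLap (hg t) φ (hcos hθ)]
  intro t₁ t₂
  rw [hM, hM]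
  have hL := contDiff_sphLap hψ
  refine integral_integral_eq_of_integral_deriv_eq_zero
    (f := fun q => sphLap (fun x => ψ (q.1, x)) q.2.1 q.2.2 * Real.sin q.2.2 * Real.cos q.2.2)
    (ContDiff.of_le (n := (⊤ : ℕ∞)) (by fun_prop) (by exact_mod_cast le_top)) (fun t => ?_) t₁ t₂
  refine Eq.trans ?_ (neg_eq_zero.mpr (integral_sin_mul_jacobian_eq_zero (hg t)))
  rw [← intervalIntegral.integral_neg]
  refine intervalIntegral.integral_congr fun φ _ => ?_
  simp only []
  rw [← intervalIntegral.integral_neg]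
  refine intervalIntegral.integral_congr_Ioo_of_le hle fun θ hθ => ?_
  have hE' := hE t φ θ hθ
  have h1 : (fun t' => LB (fun φ' θ' => ψ (t', sphPt φ' θ')) φ θ)
      = fun t' => sphLap (fun x => ψ (t', x)) φ θ :=
    funext fun t' => LB_eq_sphLap (hg t') φ (hcos hθ)
  have h2 : (fun φ' => LB (fun φ' θ' => ψ (t, sphPt φ' θ')) φ' θ + 2 * 0 * Real.sin θ)
      = fun φ' => sphLap (fun x => ψ (t, x)) φ' θ :=
    funext fun φ' => by rw [LB_eq_sphLap (hg t) φ' (hcos hθ)]; ring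
  have h3 : deriv (fun θ' => LB (fun φ' θ' => ψ (t, sphPt φ' θ')) φ θ' + 2 * 0 * Real.sin θ') θ
      = deriv (fun θ' => sphLap (fun x => ψ (t, x)) φ θ') θ := by
    refine Filter.EventuallyEq.deriv_eq ?_
    filter_upwards [Ioo_mem_nhds hθ.1 hθ.2] with θ' hθ'
    rw [LB_eq_sphLap (hg t) φ (hcos hθ')]; ring
  rw [h1, h2, h3] at hE'
  have hi : ContDiff ℝ (⊤ : ℕ∞) fun t' : ℝ => (t', φ, θ) := by fun_prop
  have hdt : HasDerivAt (fun t' => sphLap (fun x => ψ (t', x)) φ θ)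
      (deriv (fun t' => sphLap (fun x => ψ (t', x)) φ θ) t) t :=
    ((hL.comp hi).differentiable (by simp) t).hasDerivAt
  rw [((hdt.mul_const (Real.sin θ)).mul_const (Real.cos θ)).deriv]
  have hne := hcos hθ
  field_simp at hE'
  linear_combination Real.sin θ * hE'
end
end

section
/- (Rayleigh's necessary condition for linear instability of a zonal flow.) Let ω ∈ ℝ, let k be a nonzero integer, let μ ∈ ℂ with Im μ ≠ 0, let Ψ₀ : [−1,1] → ℝ be twice continuously differentiable with vorticity Υ₀(s) = (1−s²)Ψ₀''(s) − 2sΨ₀'(s) continuously differentiable, and let Φ : [−1,1] → ℂ be continuous, twice continuously differentiable on (−1,1), with Φ(−1) = Φ(1) = 0 and Φ not identically zero, satisfying the normal-mode (Rayleigh) equation ((1−s²)Φ'(s))' − [ k²/(1−s²) + (Υ₀'(s)+2ω)/(Ψ₀'(s)+μ) ]·Φ(s) = 0 for all s ∈ (−1,1). Assume moreover that s ↦ (1−s²)|Φ'(s)|² and s ↦ |Φ(s)|²/(1−s²) are integrable on (−1,1). Then ∫_{−1}^{1} (Υ₀'(s)+2ω)/|Ψ₀'(s)+μ|² · |Φ(s)|²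 ds = 0. -/
open Real MeasureTheory

noncomputable section

/-- A continuous function whose product with `1 / (1 - s²)` is integrable on `[-1, 1]`
vanishes at the right endpoint. -/
theorem eq_zero_at_one_of_intervalIntegrable_div {P : ℝ → ℝ}
    (hP : ContinuousOn P (Set.Icc (-1) 1))
    (hint : IntervalIntegrable (fun s => P s / (1 - s ^ 2)) volume (-1) 1) : P 1 = 0 := by
  by_contra hne
  have hpos : 0 < |P 1| := abs_pos.mpr hne
  have hev : ∀ᶠ s in nhdsWithin 1 (Set.Icc (-1:ℝ) 1), |P 1| / 2 < |P s| :=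
    ((hP 1 (by norm_num)).abs).eventually (lt_mem_nhds (half_lt_self hpos))
  obtain ⟨ε, hε, hball⟩ := Metric.mem_nhdsWithin_iff.mp hev
  obtain ⟨b, hb0, hb1, hbε⟩ : ∃ b : ℝ, 0 < b ∧ b < 1 ∧ 1 - b < ε :=
    ⟨max (1 / 2) (1 - ε / 2), by positivity, max_lt (by norm_num) (by linarith), by
      linarith [le_max_right (1 / 2 : ℝ) (1 - ε / 2)]⟩
  have hint' : IntervalIntegrable (fun s => P s / (1 - s ^ 2)) volume b 1 :=
    hint.mono_set (by
      rw [Set.uIcc_of_le hb1.le, Set.uIcc_of_le (by norm_num)]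
      exact Set.Icc_subset_Icc_left (by linarith))
  have hinv : IntervalIntegrable (fun s : ℝ => (s - 1)⁻¹) volume b 1 := by
    refine (hint'.norm.const_mul (4 / |P 1|)).mono_fun
      (by fun_prop) ?_
    rw [Set.uIoc_of_le hb1.le]
    refine (ae_restrict_mem measurableSet_Ioc).mono fun s hs => ?_
    rcases hs.2.eq_or_lt with rfl | hs1
    · simp
    have hPs : |P 1| / 2 < |P s| := hball ⟨by
      rw [Metric.mem_ball, Real.dist_eq, abs_lt]; constructor <;> linarith [hs.1],
      by constructor <;> linarith [hs.1]⟩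
    have h1 : 0 < 1 - s := by linarith
    have h2 : 0 < 1 + s := by linarith [hs.1]
    beta_reduce
    rw [norm_mul, norm_norm, norm_div, norm_div, norm_inv, Real.norm_eq_abs (s - 1), abs_sub_comm,
      show 1 - s ^ 2 = (1 - s) * (1 + s) by ring]
    simp only [Real.norm_eq_abs, abs_mul, abs_abs, abs_of_pos h1, abs_of_pos h2]
    rw [abs_of_pos (by norm_num : (0:ℝ) < 4), inv_eq_one_div, div_mul_div_comm,
      div_le_div_iff₀ h1 (by positivity)]
    have : |P 1| * (1 + s) ≤ 4 * |P s| := by nlinarith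
    nlinarith
  rcases intervalIntegrable_sub_inv_iff.mp hinv with h | h
  · exact hb1.ne h
  · exact h Set.right_mem_uIcc

/-- A continuous function whose product with `1 / (1 - s²)` is integrable on `[-1, 1]`
vanishes at the left endpoint. -/
theorem eq_zero_at_neg_one_of_intervalIntegrable_div {P : ℝ → ℝ}
    (hP : ContinuousOn P (Set.Icc (-1) 1))
    (hint : IntervalIntegrable (fun s => P s / (1 - s ^ 2)) volume (-1) 1) : P (-1) = 0 := by
  refine eq_zero_at_one_of_intervalIntegrable_div (P := fun s => P (-s))
    (hP.comp continuousOn_neg fun s hs => ⟨by linarith [hs.2], by linarith [hs.1]⟩) ?_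
  have h := (IntervalIntegrable.iff_comp_neg (f := fun s => P s / (1 - s ^ 2))).mp hint
  simpa using h.symm

/-- If `G` has derivative `F` on `(-1, 1)` with `F` continuous on `[-1, 1]`, and `G / (1 - s²)` is
integrable, then `F` has zero integral. -/
theorem integral_eq_zero_of_intervalIntegrable_div {F G : ℝ → ℝ}
    (hF : ContinuousOn F (Set.Icc (-1) 1))
    (hG : ∀ s ∈ Set.Ioo (-1:ℝ) 1, HasDerivAt G (F s) s)
    (hint : IntervalIntegrable (fun s => G s / (1 - s ^ 2)) volume (-1) 1) :
    ∫ s in (-1:ℝ)..1, F s = 0 := by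
  have hFi : IntervalIntegrable F volume (-1) 1 :=
    ContinuousOn.intervalIntegrable (by rwa [Set.uIcc_of_le (by norm_num)])
  have hsub : ∀ {a b : ℝ}, a ∈ Set.Icc (-1:ℝ) 1 → b ∈ Set.Icc (-1:ℝ) 1 →
      IntervalIntegrable F volume a b := fun ha hb =>
    (hF.mono (Set.uIcc_subset_Icc ha hb)).intervalIntegrable
  have h0 : (0:ℝ) ∈ Set.Icc (-1:ℝ) 1 := by norm_num
  set P : ℝ → ℝ := fun s => G 0 + ∫ t in (0:ℝ)..s, F t with hPdef
  have hPc : ContinuousOn P (Set.Icc (-1) 1) := by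
    refine continuousOn_const.add ?_
    have := intervalIntegral.continuousOn_primitive_interval' (μ := volume) (a := (0:ℝ)) hFi
      (by rwa [Set.uIcc_of_le (by norm_num)])
    rwa [Set.uIcc_of_le (by norm_num)] at this
  have hPG : ∀ s ∈ Set.Ioo (-1:ℝ) 1, P s = G s := fun s hs => by
    have := intervalIntegral.integral_eq_sub_of_hasDerivAt (a := 0) (b := s) (f := G) (f' := F)
      (fun x hx => hG x ?_) (hsub h0 (Set.Ioo_subset_Icc_self hs))
    · simp [hPdef, this]
    · exact (Set.ordConnected_Ioo.uIcc_subset (by norm_num) hs) hx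
  have hPi : IntervalIntegrable (fun s => P s / (1 - s ^ 2)) volume (-1) 1 := by
    rw [intervalIntegrable_iff_integrableOn_Ioo_of_le (by norm_num)] at hint ⊢
    exact hint.congr_fun (fun s hs => by simp only [hPG s hs]) measurableSet_Ioo
  have e1 := eq_zero_at_one_of_intervalIntegrable_div hPc hPi
  have e2 := eq_zero_at_neg_one_of_intervalIntegrable_div hPc hPi
  have := intervalIntegral.integral_interval_sub_left (hsub h0 (by norm_num : (1:ℝ) ∈ _))
    (hsub h0 (by norm_num : (-1:ℝ) ∈ _))
  rw [← this]
  simp only [hPdef] at e1 e2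
  linarith

/-- Rayleigh's necessary condition for the linear instability of a zonal flow on the rotating
sphere: if a nontrivial normal mode with `Im μ ≠ 0` exists, then
`∫_{−1}^{1} (Υ₀'(s)+2ω)/|Ψ₀'(s)+μ|² · |Φ(s)|² ds = 0`. -/
theorem rayleigh_criterion (ω : ℝ) (k : ℤ) (hk : k ≠ 0) (μ : ℂ) (hμ : μ.im ≠ 0)
    (Ψ₀ : ℝ → ℝ) (hΨ : ContDiffOn ℝ 2 Ψ₀ (Set.Icc (-1:ℝ) 1))
    (Υ₀ : ℝ → ℝ)
    (hΥdef : ∀ s ∈ Set.Icc (-1:ℝ) 1,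
      Υ₀ s = (1 - s ^ 2) * deriv (deriv Ψ₀) s - 2 * s * deriv Ψ₀ s)
    (hΥ : ContDiffOn ℝ 1 Υ₀ (Set.Icc (-1:ℝ) 1))
    (Φ : ℝ → ℂ) (hΦc : ContinuousOn Φ (Set.Icc (-1:ℝ) 1))
    (hΦ2 : ContDiffOn ℝ 2 Φ (Set.Ioo (-1:ℝ) 1))
    (hΦm : Φ (-1) = 0) (hΦp : Φ 1 = 0)
    (hΦne : ∃ s ∈ Set.Icc (-1:ℝ) 1, Φ s ≠ 0)
    (hode : ∀ s ∈ Set.Ioo (-1:ℝ) 1,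
      deriv (fun s' : ℝ => (1 - (s' : ℂ) ^ 2) * deriv Φ s') s
        - ((k : ℂ) ^ 2 / (1 - (s : ℂ) ^ 2)
            + ((deriv Υ₀ s + 2 * ω : ℝ) : ℂ) / (((deriv Ψ₀ s : ℝ) : ℂ) + μ)) * Φ s = 0)
    (hint1 : IntervalIntegrable (fun s => (1 - s ^ 2) * ‖deriv Φ s‖ ^ 2)
      MeasureTheory.volume (-1) 1)
    (hint2 : IntervalIntegrable (fun s => ‖Φ s‖ ^ 2 / (1 - s ^ 2))
      MeasureTheory.volume (-1) 1) :
    (∫ s in (-1:ℝ)..1,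
        (deriv Υ₀ s + 2 * ω) / ‖((deriv Ψ₀ s : ℝ) : ℂ) + μ‖ ^ 2 * ‖Φ s‖ ^ 2) = 0 := by
  have hnhds : ∀ s ∈ Set.Ioo (-1:ℝ) 1, Set.Icc (-1:ℝ) 1 ∈ nhds s := fun s hs =>
    Icc_mem_nhds hs.1 hs.2
  have hden : ∀ x : ℝ, (x : ℂ) + μ ≠ 0 := fun x h => hμ (by simpa using congrArg Complex.im h)
  have hdΦ : ∀ s ∈ Set.Ioo (-1:ℝ) 1, HasDerivAt Φ (deriv Φ s) s := fun s hs =>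
    ((hΦ2.differentiableOn (by norm_num)).differentiableAt
      (isOpen_Ioo.mem_nhds hs)).hasDerivAt
  have hdΦ' : ContDiffOn ℝ 1 (deriv Φ) (Set.Ioo (-1:ℝ) 1) :=
    hΦ2.deriv_of_isOpen isOpen_Ioo (by norm_num)
  set F : ℝ → ℝ := fun s => (derivWithin Υ₀ (Set.Icc (-1) 1) s + 2 * ω)
    / ‖((derivWithin Ψ₀ (Set.Icc (-1) 1) s : ℝ) : ℂ) + μ‖ ^ 2 * ‖Φ s‖ ^ 2 with hFdef
  have hu : UniqueDiffOn ℝ (Set.Icc (-1:ℝ) 1) := uniqueDiffOn_Icc (by norm_num)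
  have hF : ContinuousOn F (Set.Icc (-1) 1) := by
    have c1 := hΥ.continuousOn_derivWithin hu le_rfl
    have c2 := hΨ.continuousOn_derivWithin hu (by norm_num)
    refine ((c1.add continuousOn_const).div
      (((Complex.continuous_ofReal.comp_continuousOn c2).add continuousOn_const).norm.pow 2)
      fun s _ => ?_).mul (hΦc.norm.pow 2)
    exact pow_ne_zero _ (norm_ne_zero_iff.mpr (hden _))
  have hFeq : ∀ s ∈ Set.Ioo (-1:ℝ) 1, (deriv Υ₀ s + 2 * ω) /
      ‖((deriv Ψ₀ s : ℝ) : ℂ) + μ‖ ^ 2 * ‖Φ s‖ ^ 2 = F s := fun s hs => by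
    simp only [hFdef, derivWithin_of_mem_nhds (hnhds s hs)]
  set G : ℝ → ℝ := fun s =>
    ((1 - (s : ℂ) ^ 2) * deriv Φ s * (starRingEnd ℂ) (Φ s)).im with hGdef
  have hG : ∀ s ∈ Set.Ioo (-1:ℝ) 1, HasDerivAt G (-μ.im * F s) s := by
    intro s hs
    have hd : DifferentiableAt ℝ (fun s' : ℝ => (1 - (s' : ℂ) ^ 2) * deriv Φ s') s := by
      refine DifferentiableAt.mul ?_ ((hdΦ'.differentiableOn one_ne_zero).differentiableAt
        (isOpen_Ioo.mem_nhds hs))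
      exact (((Complex.ofRealCLM.differentiableAt).pow 2).const_sub 1)
    have h1 := Complex.imCLM.hasFDerivAt.comp_hasDerivAt s (hd.hasDerivAt.mul (hdΦ s hs).star)
    refine HasDerivAt.congr_deriv (f := G) h1 ?_
    rw [sub_eq_zero.mp (hode s hs), ← hFeq s hs]
    simp only [Complex.imCLM_apply, Complex.add_im, Complex.star_def]
    have e1 : ((1 - (s : ℂ) ^ 2) * deriv Φ s * (starRingEnd ℂ) (deriv Φ s)).im = 0 := by
      rw [mul_assoc, Complex.mul_conj]
      norm_cast
    have e2 : ((k : ℂ) ^ 2 / (1 - (s : ℂ) ^ 2)).im = 0 := by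
      have : ((k : ℂ) ^ 2 / (1 - (s : ℂ) ^ 2)) = (((k : ℝ) ^ 2 / (1 - s ^ 2) : ℝ) : ℂ) := by
        push_cast; rfl
      rw [this, Complex.ofReal_im]
    rw [e1, mul_assoc, Complex.mul_conj, Complex.im_mul_ofReal, Complex.add_im, e2,
      div_eq_mul_inv, Complex.im_ofReal_mul, Complex.inv_im, ← Complex.normSq_eq_norm_sq,
      ← Complex.normSq_eq_norm_sq]
    simp only [Complex.add_im, Complex.ofReal_im]
    ring
  have hGi : IntervalIntegrable (fun s => G s / (1 - s ^ 2)) volume (-1) 1 := by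
    rw [intervalIntegrable_iff_integrableOn_Ioo_of_le (by norm_num)] at hint1 hint2 ⊢
    refine (hint1.add hint2).mono' ?_ ?_
    · refine ContinuousOn.aestronglyMeasurable ?_ measurableSet_Ioo
      refine ContinuousOn.div (fun s hs => (hG s hs).continuousAt.continuousWithinAt)
        (by fun_prop) fun s hs => ?_
      nlinarith [hs.1, hs.2]
    · refine (ae_restrict_mem measurableSet_Ioo).mono fun s hs => ?_
      have hp : 0 < 1 - s ^ 2 := by nlinarith [hs.1, hs.2]
      have hb : |G s| ≤ (1 - s ^ 2) * ‖deriv Φ s‖ * ‖Φ s‖ := by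
        refine (Complex.abs_im_le_norm _).trans_eq ?_
        rw [norm_mul, norm_mul, RCLike.norm_conj,
          show (1 - (s : ℂ) ^ 2) = ((1 - s ^ 2 : ℝ) : ℂ) by push_cast; rfl, Complex.norm_real,
          Real.norm_of_nonneg hp.le]
      rw [norm_div, Real.norm_of_nonneg hp.le, Real.norm_eq_abs, div_le_iff₀ hp, Pi.add_apply,
        add_mul, div_mul_cancel₀ _ hp.ne']
      nlinarith [sq_nonneg ((1 - s ^ 2) * ‖deriv Φ s‖ - ‖Φ s‖),
        sq_nonneg ((1 - s ^ 2) * ‖deriv Φ s‖), sq_nonneg ‖Φ s‖]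
  have key := integral_eq_zero_of_intervalIntegrable_div (F := fun s => -μ.im * F s)
    (continuousOn_const.mul hF) hG hGi
  rw [intervalIntegral.integral_const_mul] at key
  rw [← (mul_eq_zero.mp key).resolve_left (neg_ne_zero.mpr hμ),
    intervalIntegral.integral_of_le (by norm_num), intervalIntegral.integral_of_le (by norm_num),
    integral_Ioc_eq_integral_Ioo, integral_Ioc_eq_integral_Ioo]
  exact setIntegral_congr_fun measurableSet_Ioo hFeq
end
end

section
/- (Fjortoft's necessary condition for linear instability of a zonal flow.) Let ω ∈ ℝ, let k be a nonzero integer, let μ ∈ ℂ with Im μ ≠ 0, let Ψ₀ : [−1,1] → ℝ be twice continuously differentiable with vorticity Υ₀(s) = (1−s²)Ψ₀''(s) − 2sΨ₀'(s) continuously differentiable, and let Φ : [−1,1] → ℂ be continuous, twice continuously differentiable on (−1,1), with Φ(−1) = Φ(1) = 0 and Φ not identically zero, satisfying ((1−s²)Φ'(s))' − [ k²/(1−s²) + (Υ₀'(s)+2ω)/(Ψ₀'(s)+μ) ]·Φ(s) = 0 for all s ∈ (−1,1), and such that s ↦ (1−s²)|Φ'(s)|² and s ↦ |Φ(s)|²/(1−s²)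 are integrable on (−1,1). Then for every γ ∈ ℝ there exists s₀ ∈ (−1,1) with (Υ₀'(s₀)+2ω)·(Ψ₀'(s₀)+γ) < 0. -/
open Real MeasureTheory

noncomputable section

/-- If `r ≤ C (1 - s) F s` near the right endpoint `1` with `F` integrable, then `r ≤ 0`. -/
lemma nonpos_of_le_mul_one_sub {F : ℝ → ℝ} {a r C : ℝ} (ha : a < 1)
    (hF : IntervalIntegrable F volume a 1)
    (h : ∀ s ∈ Set.Ioo a 1, r ≤ C * (1 - s) * F s) : r ≤ 0 := by
  by_contra! hr
  have key : IntervalIntegrable (fun s : ℝ => (s - 1)⁻¹) volume a 1 := by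
    refine (hF.const_mul (C / r)).mono_fun (by fun_prop) ?_
    rw [Set.uIoc_of_le ha.le, ← restrict_Ioo_eq_restrict_Ioc]
    filter_upwards [ae_restrict_mem measurableSet_Ioo] with s hs
    have hs1 : 0 < 1 - s := by linarith [hs.2]
    refine le_trans ?_ (le_abs_self _)
    rw [norm_inv, Real.norm_eq_abs, abs_sub_comm, abs_of_pos hs1, inv_le_iff_one_le_mul₀ hs1]
    have h1 := h s hs
    rw [show C / r * F s * (1 - s) = (C * (1 - s) * F s) / r by ring, le_div_iff₀ hr]
    linarith
  rcases intervalIntegrable_sub_inv_iff.1 key with h1 | h1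
  · exact ha.ne h1
  · exact h1 Set.right_mem_uIcc

/-- A function on `(-1, 1)` whose derivative dominates an integrable function `F ≥ 0`, and which
is itself bounded by a multiple of `(1 - s²) F`, vanishes identically. -/
lemma eq_zero_of_abs_le_mul_one_sub_sq {R R' F : ℝ → ℝ} {C : ℝ} (hC : 0 ≤ C)
    (hR : ∀ s ∈ Set.Ioo (-1 : ℝ) 1, HasDerivAt R (R' s) s)
    (hF0 : ∀ s ∈ Set.Ioo (-1 : ℝ) 1, 0 ≤ F s)
    (hFR : ∀ s ∈ Set.Ioo (-1 : ℝ) 1, F s ≤ R' s)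
    (hRF : ∀ s ∈ Set.Ioo (-1 : ℝ) 1, |R s| ≤ C * (1 - s ^ 2) * F s)
    (hF : IntervalIntegrable F volume (-1) 1) :
    ∀ s ∈ Set.Ioo (-1 : ℝ) 1, R s = 0 := by
  have hmono : MonotoneOn R (Set.Ioo (-1 : ℝ) 1) := by
    refine monotoneOn_of_deriv_nonneg (convex_Ioo _ _)
      (fun s hs => (hR s hs).continuousAt.continuousWithinAt) ?_ ?_
    · rw [interior_Ioo]
      exact fun s hs => (hR s hs).differentiableAt.differentiableWithinAt
    · rw [interior_Ioo]
      intro s hs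
      rw [(hR s hs).deriv]
      exact (hF0 s hs).trans (hFR s hs)
  intro a ha
  apply le_antisymm
  · refine nonpos_of_le_mul_one_sub (F := F) (C := C * 2) ha.2 (hF.mono_set ?_) ?_
    · rw [Set.uIcc_of_le ha.2.le, Set.uIcc_of_le (by norm_num)]
      exact Set.Icc_subset_Icc_left ha.1.le
    · intro s hs
      have hs' : s ∈ Set.Ioo (-1 : ℝ) 1 := ⟨ha.1.trans hs.1, hs.2⟩
      calc R a ≤ R s := hmono ha hs' hs.1.le
        _ ≤ C * (1 - s ^ 2) * F s := (le_abs_self _).trans (hRF s hs')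
        _ ≤ C * 2 * (1 - s) * F s := by
          refine mul_le_mul_of_nonneg_right ?_ (hF0 s hs')
          rw [mul_assoc]
          exact mul_le_mul_of_nonneg_left (by nlinarith [hs'.2]) hC
  · rw [← neg_nonpos]
    have hF' : IntervalIntegrable (fun s => F (-s)) volume (-a) 1 := by
      refine IntervalIntegrable.mono_set (a := -(-1)) (b := -1) ?_ ?_
      · simpa using (IntervalIntegrable.iff_comp_neg (by simp)).1 hF
      · rw [Set.uIcc_of_le (by linarith [ha.1]), Set.uIcc_of_ge (by norm_num), neg_neg]
        exact Set.Icc_subset_Icc_left (by linarith [ha.2])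
    refine nonpos_of_le_mul_one_sub (C := C * 2) (by linarith [ha.1]) hF' ?_
    intro s hs
    have hs' : -s ∈ Set.Ioo (-1 : ℝ) 1 := ⟨by linarith [hs.2], by linarith [hs.1, ha.2]⟩
    calc -R a ≤ -R (-s) := neg_le_neg (hmono hs' ha (by linarith [hs.1]))
      _ ≤ C * (1 - (-s) ^ 2) * F (-s) := (neg_le_abs _).trans (hRF _ hs')
      _ ≤ C * 2 * (1 - s) * F (-s) := by
        refine mul_le_mul_of_nonneg_right ?_ (hF0 _ hs')
        rw [mul_assoc]
        exact mul_le_mul_of_nonneg_left (by nlinarith [hs'.1]) hC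

/-- Fjortoft's necessary condition for the linear instability of a zonal flow on the rotating
sphere: if a nontrivial normal mode with `Im μ ≠ 0` exists, then for every `γ ∈ ℝ` there is
`s₀ ∈ (−1,1)` with `(Υ₀'(s₀)+2ω)·(Ψ₀'(s₀)+γ) < 0`. -/
theorem fjortoft_criterion (ω : ℝ) (k : ℤ) (hk : k ≠ 0) (μ : ℂ) (hμ : μ.im ≠ 0)
    (Ψ₀ : ℝ → ℝ) (hΨ : ContDiffOn ℝ 2 Ψ₀ (Set.Icc (-1:ℝ) 1))
    (Υ₀ : ℝ → ℝ)
    (hΥdef : ∀ s ∈ Set.Icc (-1:ℝ) 1,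
      Υ₀ s = (1 - s ^ 2) * deriv (deriv Ψ₀) s - 2 * s * deriv Ψ₀ s)
    (hΥ : ContDiffOn ℝ 1 Υ₀ (Set.Icc (-1:ℝ) 1))
    (Φ : ℝ → ℂ) (hΦc : ContinuousOn Φ (Set.Icc (-1:ℝ) 1))
    (hΦ2 : ContDiffOn ℝ 2 Φ (Set.Ioo (-1:ℝ) 1))
    (hΦm : Φ (-1) = 0) (hΦp : Φ 1 = 0)
    (hΦne : ∃ s ∈ Set.Icc (-1:ℝ) 1, Φ s ≠ 0)
    (hode : ∀ s ∈ Set.Ioo (-1:ℝ) 1,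
      deriv (fun s' : ℝ => (1 - (s' : ℂ) ^ 2) * deriv Φ s') s
        - ((k : ℂ) ^ 2 / (1 - (s : ℂ) ^ 2)
            + ((deriv Υ₀ s + 2 * ω : ℝ) : ℂ) / (((deriv Ψ₀ s : ℝ) : ℂ) + μ)) * Φ s = 0)
    (hint1 : IntervalIntegrable (fun s => (1 - s ^ 2) * ‖deriv Φ s‖ ^ 2)
      MeasureTheory.volume (-1) 1)
    (hint2 : IntervalIntegrable (fun s => ‖Φ s‖ ^ 2 / (1 - s ^ 2))
      MeasureTheory.volume (-1) 1) :
    ∀ γ : ℝ, ∃ s₀ ∈ Set.Ioo (-1:ℝ) 1,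
      (deriv Υ₀ s₀ + 2 * ω) * (deriv Ψ₀ s₀ + γ) < 0 := by
  intro γ
  by_contra! hA
  set t : ℝ := (μ.re - γ) / μ.im with ht
  set w : ℂ := ⟨1, -t⟩ with hw
  set F : ℝ → ℝ := fun s => (1 - s ^ 2) * ‖deriv Φ s‖ ^ 2 + ‖Φ s‖ ^ 2 / (1 - s ^ 2) with hFdef
  set V : ℝ → ℂ := fun s => (k : ℂ) ^ 2 / (1 - (s : ℂ) ^ 2)
    + ((deriv Υ₀ s + 2 * ω : ℝ) : ℂ) / (((deriv Ψ₀ s : ℝ) : ℂ) + μ) with hV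
  set R : ℝ → ℝ := fun s =>
    (w * ((1 - (s : ℂ) ^ 2) * deriv Φ s * (starRingEnd ℂ) (Φ s))).re
  set R' : ℝ → ℝ := fun s => (w * (V s * Φ s * (starRingEnd ℂ) (Φ s)
    + (1 - (s : ℂ) ^ 2) * deriv Φ s * (starRingEnd ℂ) (deriv Φ s))).re with hR'def
  have hd : ∀ s ∈ Set.Ioo (-1 : ℝ) 1, 0 < 1 - s ^ 2 := fun s hs => by nlinarith [hs.1, hs.2]
  have hF0 : ∀ s ∈ Set.Ioo (-1 : ℝ) 1, 0 ≤ F s := fun s hs => by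
    have := hd s hs
    positivity
  have hR : ∀ s ∈ Set.Ioo (-1 : ℝ) 1, HasDerivAt R (R' s) s := by
    intro s hs
    have hΦs : HasDerivAt Φ (deriv Φ s) s :=
      ((hΦ2.differentiableOn (by norm_num)).differentiableAt (isOpen_Ioo.mem_nhds hs)).hasDerivAt
    have hΦs' : DifferentiableAt ℝ (deriv Φ) s :=
      (((contDiffOn_succ_iff_deriv_of_isOpen (n := 1) isOpen_Ioo).1 hΦ2).2.2.differentiableOn
        (by norm_num)).differentiableAt (isOpen_Ioo.mem_nhds hs)
    have hP : DifferentiableAt ℝ (fun s' : ℝ => (1 - (s' : ℂ) ^ 2) * deriv Φ s') s := by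
      refine DifferentiableAt.mul ?_ hΦs'
      exact (differentiableAt_const _).sub (Complex.ofRealCLM.differentiableAt.pow 2)
    have hP' := hP.hasDerivAt
    rw [sub_eq_zero.1 (hode s hs)] at hP'
    have hc : HasDerivAt (fun s => (starRingEnd ℂ) (Φ s)) ((starRingEnd ℂ) (deriv Φ s)) s :=
      hΦs.star
    exact Complex.reCLM.hasFDerivAt.comp_hasDerivAt s ((hP'.mul hc).const_mul w)
  have hFR : ∀ s ∈ Set.Ioo (-1 : ℝ) 1, F s ≤ R' s := by
    intro s hs
    have hds := hd s hs
    have hk2 : (1 : ℝ) ≤ (k : ℝ) ^ 2 := by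
      exact_mod_cast Int.add_one_le_iff.2 (sq_pos_of_ne_zero hk)
    set A := deriv Υ₀ s + 2 * ω
    set p := deriv Ψ₀ s
    have hwμ : (w / ((p : ℂ) + μ)).re = (p + γ) / Complex.normSq ((p : ℂ) + μ) := by
      rw [Complex.div_re, ← add_div]
      congr 1
      simp [hw, ht]
      field_simp
      ring
    have heq : R' s = (1 - s ^ 2) * ‖deriv Φ s‖ ^ 2 + k ^ 2 * (‖Φ s‖ ^ 2 / (1 - s ^ 2))
        + A * (p + γ) * (‖Φ s‖ ^ 2 / Complex.normSq ((p : ℂ) + μ)) := by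
      have h1 : w * (V s * Φ s * (starRingEnd ℂ) (Φ s)
          + (1 - (s : ℂ) ^ 2) * deriv Φ s * (starRingEnd ℂ) (deriv Φ s))
          = (((1 - s ^ 2) * ‖deriv Φ s‖ ^ 2 + k ^ 2 * (‖Φ s‖ ^ 2 / (1 - s ^ 2)) : ℝ) : ℂ) * w
            + ((A * ‖Φ s‖ ^ 2 : ℝ) : ℂ) * (w / ((p : ℂ) + μ)) := by
        rw [mul_assoc (V s), mul_assoc _ (deriv Φ s), Complex.mul_conj', Complex.mul_conj']
        rw [show V s = (k : ℂ) ^ 2 / (1 - (s : ℂ) ^ 2) + (A : ℂ) / ((p : ℂ) + μ) from rfl]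
        push_cast
        ring
      simp only [hR'def]
      rw [h1, Complex.add_re, Complex.re_ofReal_mul, Complex.re_ofReal_mul, hwμ]
      simp only [hw]
      ring
    have h2 : 0 ≤ A * (p + γ) * (‖Φ s‖ ^ 2 / Complex.normSq ((p : ℂ) + μ)) :=
      mul_nonneg (hA s hs) (div_nonneg (sq_nonneg _) (Complex.normSq_nonneg _))
    have h3 : 0 ≤ ‖Φ s‖ ^ 2 / (1 - s ^ 2) := by positivity
    rw [heq]
    simp only [hFdef]
    nlinarith
  have hRF : ∀ s ∈ Set.Ioo (-1 : ℝ) 1, |R s| ≤ ‖w‖ * (1 - s ^ 2) * F s := by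
    intro s hs
    have hds := hd s hs
    refine (Complex.abs_re_le_norm _).trans ?_
    have hn : ‖(1 - (s : ℂ) ^ 2)‖ = 1 - s ^ 2 := by
      rw [← abs_of_pos hds, ← Real.norm_eq_abs, ← Complex.norm_real]
      push_cast
      rfl
    rw [norm_mul, norm_mul, norm_mul, hn, RCLike.norm_conj, mul_assoc, mul_assoc]
    gcongr
    simp only [hFdef]
    rw [← sub_nonneg]
    have : (1 - s ^ 2) * ‖deriv Φ s‖ ^ 2 + ‖Φ s‖ ^ 2 / (1 - s ^ 2) - ‖deriv Φ s‖ * ‖Φ s‖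
        = (((1 - s ^ 2) * ‖deriv Φ s‖ - ‖Φ s‖) ^ 2 + (1 - s ^ 2) * ‖deriv Φ s‖ * ‖Φ s‖)
          / (1 - s ^ 2) := by
      field_simp
      ring
    rw [this]
    positivity
  have hR0 := eq_zero_of_abs_le_mul_one_sub_sq (norm_nonneg w) hR hF0 hFR hRF (hint1.add hint2)
  obtain ⟨s, hs, hne⟩ := hΦne
  have hs' : s ∈ Set.Ioo (-1 : ℝ) 1 := by
    refine ⟨lt_of_le_of_ne hs.1 ?_, lt_of_le_of_ne hs.2 ?_⟩
    · rintro rfl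
      exact hne hΦm
    · rintro rfl
      exact hne hΦp
  have hR's : R' s = 0 := by
    refine (hR s hs').unique ((hasDerivAt_const s (0 : ℝ)).congr_of_eventuallyEq ?_)
    filter_upwards [isOpen_Ioo.mem_nhds hs'] with x hx using hR0 x hx
  have hFs : 0 < F s := by
    have := hd s hs'
    have := norm_pos_iff.2 hne
    positivity
  linarith [hFR s hs']
end
end
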